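/- Mutual information inequality along the heat semigroup (quantum conditioning): Let X and Y be random variables with values in ℝⁿ correlated with a finite-dimensional quantum system M, with E‖X‖² and E‖Y‖² finite, with the map (x,y) ↦ ρ(x,y) (the state of M conditioned on X = x, Y = y) continuous in trace norm, with all conditional entropies appearing below finite, and with I(X:Y|M) = 0. Let Z be a standard Gaussian random variable on ℝⁿ independent of (X, Y, M). Then for every t ≥ 0 and every 0 ≤ λ ≤ 1, I( X + Y + √t Z : Z | M ) ≤ I( X + λ√t Z : Z | M ) + I( Y + (1−λ)√t Z : Z | M ). -/

import Mathlib

open MeasureTheory Real Filter Topology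
open scoped ComplexOrder

noncomputable section

/-- `ℝⁿ`. -/
abbrev En (n : ℕ) := EuclideanSpace ℝ (Fin n)

/-- The density of the standard Gaussian probability measure on `ℝⁿ`. -/
def gaussDensity (n : ℕ) (z : En n) : ℝ :=
  (2 * π) ^ (-(n : ℝ) / 2) * Real.exp (-‖z‖ ^ 2 / 2)

/-- A state of a finite-dimensional quantum system: a positive semidefinite matrix
with unit trace. -/
def IsState {ι : Type*} [Fintype ι] [DecidableEq ι] (ρ : Matrix ι ι ℂ) : Prop :=
  ρ.PosSemidef ∧ ρ.trace = 1

open scoped Classical in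
/-- The von Neumann entropy `S(ρ) = -Σᵢ λᵢ ln λᵢ` of a (Hermitian) matrix, the sum running
over its eigenvalues (with the convention `0 ln 0 = 0`; junk value `0` on
non-Hermitian matrices). -/
def vnEnt {ι : Type*} [Fintype ι] [DecidableEq ι] (ρ : Matrix ι ι ℂ) : ℝ :=
  if h : ρ.IsHermitian then -∑ i, h.eigenvalues i * Real.log (h.eigenvalues i) else 0

/-- The classical (differential or discrete) entropy `S = -∫ p ln p` of a density `p`. -/
def clEnt {α : Type*} [MeasureSpace α] (p : α → ℝ) : ℝ := -∫ a, p a * Real.log (p a)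

/-- The average state `∫ p(a) ρ(a) da` of a classical-quantum state. -/
def avgState {α : Type*} [MeasureSpace α] {d : ℕ} (p : α → ℝ)
    (ρ : α → Matrix (Fin d) (Fin d) ℂ) : Matrix (Fin d) (Fin d) ℂ :=
  Matrix.of fun i j => ∫ a, (p a : ℂ) * ρ a i j

/-- The conditional entropy `S(A|M) = S(M|A) + S(A) - S(M)` of the classical system `A`
of a classical-quantum state `(p, ρ)` given the quantum system `M`. -/
def condEnt {α : Type*} [MeasureSpace α] {d : ℕ} (p : α → ℝ)
    (ρ : α → Matrix (Fin d) (Fin d) ℂ) : ℝ :=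
  (∫ a, p a * vnEnt (ρ a)) + clEnt p - vnEnt (avgState p ρ)

/-- The integrability conditions expressing that the conditional entropy `S(A|M)` of the
classical-quantum state `(p, ρ)` is finite. -/
def EntFinite {α : Type*} [MeasureSpace α] {d : ℕ} (p : α → ℝ)
    (ρ : α → Matrix (Fin d) (Fin d) ℂ) : Prop :=
  Integrable (fun a => p a * Real.log (p a)) ∧ Integrable (fun a => p a * vnEnt (ρ a))

/-- The marginal density of the first variable of a joint density on `ℝⁿ × ℝⁿ`. -/
def margFst {n : ℕ} (p : En n × En n → ℝ) : En n → ℝ := fun x => ∫ y, p (x, y)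

/-- The state of `M` conditioned on the first classical variable:
`ρ_X(x) = (∫ p(x,y) ρ(x,y) dy) / p_X(x)`. -/
def margFstState {n d : ℕ} (p : En n × En n → ℝ)
    (ρ : En n × En n → Matrix (Fin d) (Fin d) ℂ) : En n → Matrix (Fin d) (Fin d) ℂ :=
  fun x => ((margFst p x : ℂ))⁻¹ • Matrix.of fun i j => ∫ y, (p (x, y) : ℂ) * ρ (x, y) i j

/-- The marginal density of the second variable of a joint density on `ℝⁿ × ℝⁿ`. -/
def margSnd {n : ℕ} (p : En n × En n → ℝ) : En n → ℝ := fun y => ∫ x, p (x, y)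

/-- The state of `M` conditioned on the second classical variable. -/
def margSndState {n d : ℕ} (p : En n × En n → ℝ)
    (ρ : En n × En n → Matrix (Fin d) (Fin d) ℂ) : En n → Matrix (Fin d) (Fin d) ℂ :=
  fun y => ((margSnd p y : ℂ))⁻¹ • Matrix.of fun i j => ∫ x, (p (x, y) : ℂ) * ρ (x, y) i j

/-- The density of the sum `X + Y`: `p_S(s) = ∫ p(x, s - x) dx`. -/
def sumDensity {n : ℕ} (p : En n × En n → ℝ) : En n → ℝ := fun s => ∫ x, p (x, s - x)

/-- The state of `M` conditioned on `X + Y = s`. -/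
def sumState {n d : ℕ} (p : En n × En n → ℝ)
    (ρ : En n × En n → Matrix (Fin d) (Fin d) ℂ) : En n → Matrix (Fin d) (Fin d) ℂ :=
  fun s => ((sumDensity p s : ℂ))⁻¹ •
    Matrix.of fun i j => ∫ x, (p (x, s - x) : ℂ) * ρ (x, s - x) i j

/-- The conditional mutual information `I(X:Y|M) = S(X|M) + S(Y|M) - S(X,Y|M)` of the two
classical variables of a joint classical-quantum state on `ℝⁿ × ℝⁿ` given `M`. -/
def condMI {n d : ℕ} (p : En n × En n → ℝ)
    (ρ : En n × En n → Matrix (Fin d) (Fin d) ℂ) : ℝ :=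
  condEnt (margFst p) (margFstState p ρ) + condEnt (margSnd p) (margSndState p ρ)
    - condEnt p ρ

/-- The joint density of `(A + c Z, Z)` where `A` has density `q` and `Z` is an independent
standard Gaussian. -/
def noisyDensity {n : ℕ} (c : ℝ) (q : En n → ℝ) : En n × En n → ℝ :=
  fun wz => gaussDensity n wz.2 * q (wz.1 - c • wz.2)

/-- The state of `M` conditioned on `A + c Z = w` and `Z = z`, namely `σ(w - c z)`. -/
def noisyState {n d : ℕ} (c : ℝ) (σ : En n → Matrix (Fin d) (Fin d) ℂ) :
    En n × En n → Matrix (Fin d) (Fin d) ℂ :=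
  fun wz => σ (wz.1 - c • wz.2)

/-- The mutual information `I(A + c Z : Z | M)` for a classical-quantum state `(q, σ)`. -/
def noisyMI {n d : ℕ} (c : ℝ) (q : En n → ℝ) (σ : En n → Matrix (Fin d) (Fin d) ℂ) : ℝ :=
  condMI (noisyDensity c q) (noisyState c σ)

/-- The heat-semigroup-evolved conditional entropy `t ↦ S(A + √t Z | M)`. -/
def heatEnt {n d : ℕ} (q : En n → ℝ) (σ : En n → Matrix (Fin d) (Fin d) ℂ) (t : ℝ) : ℝ :=
  condEnt (margFst (noisyDensity (Real.sqrt t) q))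
    (margFstState (noisyDensity (Real.sqrt t) q) (noisyState (Real.sqrt t) σ))

/-- The difference quotient `I(A + √t Z : Z | M) / t` whose limit as `t → 0⁺` is the
conditional Fisher information `J(A|M)`. -/
def fisherSlope {n d : ℕ} (q : En n → ℝ) (σ : En n → Matrix (Fin d) (Fin d) ℂ) (t : ℝ) : ℝ :=
  noisyMI (Real.sqrt t) q σ / t

/-- The conditional Fisher information `J(A|M) = lim_{t→0⁺} I(A + √t Z : Z | M) / t`, as an
extended real number (the limit always exists, and is computed here as a `limsup`). -/
def condFisher {n d : ℕ} (q : En n → ℝ) (σ : En n → Matrix (Fin d) (Fin d) ℂ) : EReal :=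
  Filter.limsup (fun t : ℝ => ((fisherSlope q σ t : ℝ) : EReal)) (𝓝[>] (0 : ℝ))

/-- The basic regularity hypotheses on a classical-quantum state `(p, ρ)`:
`p` is a probability density and `ρ` is a (trace-norm continuous) family of states. -/
def IsCQState {α : Type*} [MeasureSpace α] [TopologicalSpace α] {d : ℕ} (p : α → ℝ)
    (ρ : α → Matrix (Fin d) (Fin d) ℂ) : Prop :=
  Measurable p ∧ (∀ a, 0 ≤ p a) ∧ (∫ a, p a) = 1 ∧ Continuous ρ ∧ ∀ a, IsState (ρ a)





abbrev Mat (d : ℕ) := Matrix (Fin d) (Fin d) ℂ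

/-- real part of the trace -/
def rtr {d : ℕ} (A : Mat d) : ℝ := A.trace.re

/-- matrix logarithm -/
def mlog {d : ℕ} (B : Mat d) : Mat d := cfc Real.log B

/-- entrywise integral -/
def matInt {α : Type*} [MeasurableSpace α] {d : ℕ} (μ : Measure α) (G : α → Mat d) : Mat d :=
  Matrix.of fun i j => ∫ a, G a i j ∂μ

/-- quantum relative entropy -/
def relD {d : ℕ} (A B : Mat d) : ℝ := -vnEnt A - rtr (A * mlog B)

open Matrix in
theorem herm_decomp {d : ℕ} {A : Mat d} (hA : A.IsHermitian) :
    ∃ U : Mat d, Uᴴ * U = 1 ∧ U * Uᴴ = 1 ∧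
      (∀ f : ℝ → ℝ, cfc f A = U * diagonal (fun i => (f (hA.eigenvalues i) : ℂ)) * Uᴴ) ∧
      A = U * diagonal (fun i => (hA.eigenvalues i : ℂ)) * Uᴴ := by
  refine ⟨hA.eigenvectorUnitary, ?_, ?_, fun f => ?_, ?_⟩
  · have := Unitary.coe_star_mul_self hA.eigenvectorUnitary
    simpa [star_eq_conjTranspose] using this
  · have := Unitary.coe_mul_star_self hA.eigenvectorUnitary
    simpa [star_eq_conjTranspose] using this
  · rw [hA.cfc_eq f, IsHermitian.cfc, Unitary.conjStarAlgAut_apply]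
    rfl
  · conv_lhs => rw [hA.spectral_theorem, Unitary.conjStarAlgAut_apply]
    rfl

theorem vnEnt_eq {d : ℕ} {A : Mat d} (hA : A.IsHermitian) :
    vnEnt A = ∑ i, Real.negMulLog (hA.eigenvalues i) := by
  simp [vnEnt, hA, Real.negMulLog, Finset.sum_neg_distrib]

theorem rtr_eq {d : ℕ} {A : Mat d} (hA : A.IsHermitian) :
    rtr A = ∑ i, hA.eigenvalues i := by
  simp [rtr, hA.trace_eq_sum_eigenvalues]

open Matrix in
theorem trace_two {d : ℕ} (U V : Mat d) (a b : Fin d → ℝ) :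
    rtr (U * diagonal (fun i => (a i : ℂ)) * Uᴴ * (V * diagonal (fun i => (b i : ℂ)) * Vᴴ))
      = ∑ i, ∑ j, Complex.normSq ((Uᴴ * V) i j) * (a i * b j) := by
  have h : (U * diagonal (fun i => (a i : ℂ)) * Uᴴ * (V * diagonal (fun i => (b i : ℂ)) * Vᴴ)).trace
      = (diagonal (fun i => (a i : ℂ)) * (Uᴴ * V) * (diagonal (fun i => (b i : ℂ)) * (Uᴴ * V)ᴴ)).trace := by
    rw [Matrix.conjTranspose_mul, Matrix.conjTranspose_conjTranspose]
    simp only [Matrix.mul_assoc]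
    rw [Matrix.trace_mul_comm]
    simp only [Matrix.mul_assoc]
  unfold rtr
  rw [h]
  generalize Uᴴ * V = W
  simp only [Matrix.trace, Matrix.diag_apply, Matrix.mul_apply (M := _ * _), Matrix.diagonal_mul,
    Matrix.conjTranspose_apply, Complex.re_sum]
  refine Finset.sum_congr rfl fun i _ => Finset.sum_congr rfl fun j _ => ?_
  simp [Complex.normSq_apply]
  ring

open Matrix in
theorem unitary_sums {d : ℕ} (U V : Mat d) (hU : Uᴴ * U = 1) (hU' : U * Uᴴ = 1) (hV : Vᴴ * V = 1)
    (hV' : V * Vᴴ = 1) :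
    (∀ i, ∑ j, Complex.normSq ((Uᴴ * V) i j) = 1) ∧ (∀ j, ∑ i, Complex.normSq ((Uᴴ * V) i j) = 1) := by
  have h1 : (Uᴴ * V) * (Uᴴ * V)ᴴ = 1 := by
    rw [Matrix.conjTranspose_mul, Matrix.conjTranspose_conjTranspose, Matrix.mul_assoc,
      ← Matrix.mul_assoc V, hV', Matrix.one_mul, hU]
  have h2 : (Uᴴ * V)ᴴ * (Uᴴ * V) = 1 := by
    rw [Matrix.conjTranspose_mul, Matrix.conjTranspose_conjTranspose, Matrix.mul_assoc,
      ← Matrix.mul_assoc U, hU', Matrix.one_mul, hV]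
  generalize Uᴴ * V = W at *
  constructor
  · intro i
    have := congrArg Complex.re (congrFun (congrFun h1 i) i)
    simpa [Matrix.mul_apply, Complex.normSq_apply] using this
  · intro i
    have := congrArg Complex.re (congrFun (congrFun h2 i) i)
    simpa [Matrix.mul_apply, Complex.normSq_apply] using this

open Matrix in
/-- the linearised functional -/
def ell {d : ℕ} (s : ℝ) (Δ A B : Mat d) : ℝ :=
  2 / (1 + s) * rtr (Δᴴ * (A - B)) - rtr (Δᴴ * B * Δ) - s * rtr (Δ * A * Δᴴ)

open Matrix in
theorem ell_eq {d : ℕ} (s : ℝ) (U V y : Mat d) (a b : Fin d → ℝ)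
    (hU : Uᴴ * U = 1) (hV : Vᴴ * V = 1) :
    ell s (V * y * Uᴴ) (U * diagonal (fun i => (a i : ℂ)) * Uᴴ) (V * diagonal (fun i => (b i : ℂ)) * Vᴴ)
      = ∑ i, ∑ j, (2 / (1 + s) * (y j i * (Uᴴ * V) i j).re * (a i - b j)
          - (b j + s * a i) * Complex.normSq (y j i)) := by
  set Da : Mat d := diagonal (fun i => (a i : ℂ)) with hDa
  set Db : Mat d := diagonal (fun i => (b i : ℂ)) with hDb
  have e1 : ((V * y * Uᴴ)ᴴ * (U * Da * Uᴴ)).trace = (Da * ((Uᴴ * V) * y)ᴴ).trace := by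
    simp only [Matrix.conjTranspose_mul, Matrix.conjTranspose_conjTranspose]
    rw [Matrix.trace_mul_comm]
    have : U * Da * Uᴴ * (U * (yᴴ * Vᴴ)) = U * (Da * (yᴴ * Vᴴ)) := by
      simp only [Matrix.mul_assoc]
      rw [← Matrix.mul_assoc Uᴴ U, hU, Matrix.one_mul]
    rw [this, Matrix.trace_mul_comm]
    simp only [Matrix.mul_assoc]
  have e2 : ((V * y * Uᴴ)ᴴ * (V * Db * Vᴴ)).trace = (Db * (y * (Uᴴ * V))ᴴ).trace := by
    simp only [Matrix.conjTranspose_mul, Matrix.conjTranspose_conjTranspose]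
    have : U * (yᴴ * Vᴴ) * (V * Db * Vᴴ) = U * yᴴ * (Db * Vᴴ) := by
      simp only [Matrix.mul_assoc]
      rw [← Matrix.mul_assoc Vᴴ V, hV, Matrix.one_mul]
    rw [this, Matrix.trace_mul_comm]
    simp only [Matrix.mul_assoc]
  have e3 : ((V * y * Uᴴ)ᴴ * (V * Db * Vᴴ) * (V * y * Uᴴ)).trace = (yᴴ * (Db * y)).trace := by
    simp only [Matrix.conjTranspose_mul, Matrix.conjTranspose_conjTranspose]
    have : U * (yᴴ * Vᴴ) * (V * Db * Vᴴ) * (V * y * Uᴴ) = U * (yᴴ * (Db * (y * Uᴴ))) := by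
      simp only [Matrix.mul_assoc]
      rw [← Matrix.mul_assoc Vᴴ V, hV, Matrix.one_mul, ← Matrix.mul_assoc Vᴴ V, hV, Matrix.one_mul]
    rw [this, Matrix.trace_mul_comm]
    simp only [Matrix.mul_assoc]
    rw [hU, Matrix.mul_one]
  have e4 : ((V * y * Uᴴ) * (U * Da * Uᴴ) * (V * y * Uᴴ)ᴴ).trace = (y * (Da * yᴴ)).trace := by
    simp only [Matrix.conjTranspose_mul, Matrix.conjTranspose_conjTranspose]
    have : V * y * Uᴴ * (U * Da * Uᴴ) * (U * (yᴴ * Vᴴ)) = V * (y * (Da * (yᴴ * Vᴴ))) := by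
      simp only [Matrix.mul_assoc]
      rw [← Matrix.mul_assoc Uᴴ U, hU, Matrix.one_mul, ← Matrix.mul_assoc Uᴴ U, hU, Matrix.one_mul]
    rw [this, Matrix.trace_mul_comm]
    simp only [Matrix.mul_assoc]
    rw [hV, Matrix.mul_one]
  unfold ell rtr
  rw [Matrix.mul_sub, Matrix.trace_sub, e1, e2, e3, e4]
  generalize Uᴴ * V = W
  have f1 : (Da * (W * y)ᴴ).trace.re = ∑ i, ∑ j, (y j i * W i j).re * a i := by
    simp only [Matrix.trace, Matrix.diag_apply, hDa, Matrix.diagonal_mul, Matrix.conjTranspose_apply,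
      Matrix.mul_apply (M := W), Complex.re_sum, star_sum, Finset.mul_sum]
    refine Finset.sum_congr rfl fun i _ => Finset.sum_congr rfl fun j _ => ?_
    simp
    ring
  have f2 : (Db * (y * W)ᴴ).trace.re = ∑ i, ∑ j, (y j i * W i j).re * b j := by
    rw [Finset.sum_comm]
    simp only [Matrix.trace, Matrix.diag_apply, hDb, Matrix.diagonal_mul, Matrix.conjTranspose_apply,
      Matrix.mul_apply (M := y), Complex.re_sum, star_sum, Finset.mul_sum]
    refine Finset.sum_congr rfl fun i _ => Finset.sum_congr rfl fun j _ => ?_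
    simp
    ring
  have f3 : (yᴴ * (Db * y)).trace.re = ∑ i, ∑ j, b j * Complex.normSq (y j i) := by
    simp only [Matrix.trace, Matrix.diag_apply, hDb, Matrix.diagonal_mul, Matrix.conjTranspose_apply,
      Matrix.mul_apply (M := yᴴ), Complex.re_sum]
    refine Finset.sum_congr rfl fun i _ => Finset.sum_congr rfl fun j _ => ?_
    simp [Complex.normSq_apply]
    ring
  have f4 : (y * (Da * yᴴ)).trace.re = ∑ i, ∑ j, a i * Complex.normSq (y j i) := by
    rw [Finset.sum_comm]
    simp only [Matrix.trace, Matrix.diag_apply, hDa, Matrix.diagonal_mul, Matrix.conjTranspose_apply,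
      Matrix.mul_apply (M := y), Complex.re_sum]
    refine Finset.sum_congr rfl fun i _ => Finset.sum_congr rfl fun j _ => ?_
    simp [Complex.normSq_apply]
    ring
  rw [Complex.sub_re, f1, f2, f3, f4]
  simp only [Finset.mul_sum, ← Finset.sum_sub_distrib]
  refine Finset.sum_congr rfl fun i _ => Finset.sum_congr rfl fun j _ => ?_
  ring

/-- scalar integrand -/
def psiS (a b s : ℝ) : ℝ := (a - b) ^ 2 / ((b + s * a) * (1 + s) ^ 2)

theorem psiS_integral {a b : ℝ} (ha : 0 ≤ a) (hb : 0 ≤ b) (hab : b = 0 → a = 0) :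
    IntegrableOn (psiS a b) (Set.Ioi 0) ∧
      ∫ s in Set.Ioi 0, psiS a b s = a * Real.log a - a * Real.log b - a + b := by
  rcases hb.eq_or_lt with hb0 | hb0
  · have h0 := hab hb0.symm
    subst h0; subst hb0
    constructor
    · have : psiS 0 0 = fun _ => 0 := by funext s; simp [psiS]
      rw [this]; exact integrableOn_zero
    · simp [psiS]
  rcases ha.eq_or_lt with ha0 | ha0
  · subst ha0
    have hp : psiS 0 b = fun s => b * (1 / (1 + s) ^ 2) := by
      funext s
      simp only [psiS, mul_zero, add_zero]
      by_cases h : 1 + s = 0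
      · simp [h]
      · field_simp; ring
    have hd : ∀ x ∈ Set.Ioi (0:ℝ), HasDerivAt (fun s : ℝ => -(1 + s)⁻¹) (1 / (1 + x) ^ 2) x := by
      intro x hx
      have hx' : (1 + x) ≠ 0 := by have : 0 < x := hx; positivity
      have := ((hasDerivAt_id x).const_add 1).inv hx'
      refine HasDerivAt.congr_deriv (f := fun s : ℝ => -(1 + s)⁻¹) this.neg ?_
      simp [neg_div]
    have hc : ContinuousWithinAt (fun s : ℝ => -(1 + s)⁻¹) (Set.Ici 0) 0 := by
      apply ContinuousAt.continuousWithinAt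
      fun_prop (disch := norm_num)
    have ht : Tendsto (fun s : ℝ => -(1 + s)⁻¹) atTop (𝓝 0) := by
      rw [← neg_zero]
      exact (tendsto_inv_atTop_zero.comp (tendsto_atTop_add_const_left _ _ tendsto_id)).neg
    have hn : ∀ x ∈ Set.Ioi (0:ℝ), 0 ≤ 1 / (1 + x) ^ 2 := fun x _ => by positivity
    rw [hp]
    constructor
    · exact (integrableOn_Ioi_deriv_of_nonneg hc hd hn ht).const_mul b
    · rw [integral_const_mul, integral_Ioi_of_hasDerivAt_of_nonneg hc hd hn ht]
      simp
  · have hd : ∀ x ∈ Set.Ioi (0:ℝ), HasDerivAt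
        (fun s : ℝ => a * Real.log ((b + s * a) / (1 + s)) + (a - b) * (1 + s)⁻¹) (psiS a b x) x := by
      intro x hx
      have hx0 : 0 < x := hx
      have hx' : (1 + x) ≠ 0 := by positivity
      have hx2 : (b + x * a) ≠ 0 := by positivity
      have h1 := ((hasDerivAt_id x).const_add 1)
      have h2 := ((hasDerivAt_id x).mul_const a).const_add b
      have h3 := (h2.div h1 hx').log (div_ne_zero hx2 hx')
      refine HasDerivAt.congr_deriv (f := fun s : ℝ => a * Real.log ((b + s * a) / (1 + s)) + (a - b) * (1 + s)⁻¹)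
        ((h3.const_mul a).add ((h1.inv hx').const_mul (a - b))) ?_
      simp only [psiS, id, Pi.div_apply]
      field_simp
      ring
    have hc : ContinuousWithinAt (fun s : ℝ => a * Real.log ((b + s * a) / (1 + s)) + (a - b) * (1 + s)⁻¹)
        (Set.Ici 0) 0 := by
      apply ContinuousAt.continuousWithinAt
      have : (b + 0 * a) / (1 + 0) ≠ 0 := by simp; exact hb0.ne'
      fun_prop (disch := first | norm_num | assumption)
    have ht : Tendsto (fun s : ℝ => a * Real.log ((b + s * a) / (1 + s)) + (a - b) * (1 + s)⁻¹) atTop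
        (𝓝 (a * Real.log a)) := by
      have hi : Tendsto (fun s : ℝ => (1 + s)⁻¹) atTop (𝓝 0) :=
        (tendsto_inv_atTop_zero.comp (tendsto_atTop_add_const_left _ _ tendsto_id))
      have h5 : Tendsto (fun s : ℝ => (b + s * a) / (1 + s)) atTop (𝓝 a) := by
        have : Tendsto (fun s : ℝ => a + (b - a) * (1 + s)⁻¹) atTop (𝓝 (a + (b - a) * 0)) :=
          (hi.const_mul _).const_add _
        simp only [mul_zero, add_zero] at this
        refine this.congr' ?_
        filter_upwards [eventually_gt_atTop 0] with s hs
        have : (1 + s) ≠ 0 := by positivity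
        field_simp; ring
      have := ((h5.log ha0.ne').const_mul a).add (hi.const_mul (a - b))
      simpa using this
    have hn : ∀ x ∈ Set.Ioi (0:ℝ), 0 ≤ psiS a b x := fun x hx => by
      have : 0 < x := hx
      unfold psiS; positivity
    constructor
    · exact integrableOn_Ioi_deriv_of_nonneg hc hd hn ht
    · rw [integral_Ioi_of_hasDerivAt_of_nonneg hc hd hn ht]
      simp
      ring

theorem ell_scalar {a b s : ℝ} (hs : 0 < s) (ha : 0 ≤ a) (hb : 0 ≤ b) (y w : ℂ) :
    2 / (1 + s) * (y * w).re * (a - b) - (b + s * a) * Complex.normSq y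
      ≤ Complex.normSq w * psiS a b s := by
  have h1 : (y * w).re ^ 2 ≤ Complex.normSq y * Complex.normSq w := by
    rw [← Complex.normSq_mul, Complex.normSq_apply (y * w)]
    nlinarith [sq_nonneg (y * w).im]
  have hsa : 0 ≤ s * a := by positivity
  rcases (add_nonneg hb hsa).eq_or_lt with h0 | h0
  · have hb0 : b = 0 := by linarith
    have ha0 : a = 0 := by
      have : s * a = 0 := by linarith
      rcases mul_eq_zero.1 this with h | h
      · exact absurd h hs.ne'
      · exact h
    subst hb0; subst ha0; simp [psiS]
  · have h1s : 0 < 1 + s := by linarith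
    unfold psiS
    rw [mul_div_assoc', le_div_iff₀ (by positivity)]
    set k := b + s * a
    set r := (y * w).re
    have e : (2 / (1 + s) * r * (a - b) - k * Complex.normSq y) * (k * (1 + s) ^ 2)
        = 2 * (k * (1 + s)) * r * (a - b) - (k * (1 + s)) ^ 2 * Complex.normSq y := by
      field_simp
    rw [e]
    rcases (Complex.normSq_nonneg w).eq_or_lt with hw | hw
    · rw [← hw] at h1 ⊢
      have : r = 0 := by nlinarith
      rw [this]
      have := Complex.normSq_nonneg y
      nlinarith [mul_nonneg (sq_nonneg (k * (1 + s))) this]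
    · have h2 : r ^ 2 / Complex.normSq w ≤ Complex.normSq y := by
        rw [div_le_iff₀ hw]; exact h1
      have h3 : (k * (1 + s)) ^ 2 * (r ^ 2 / Complex.normSq w) ≤ (k * (1 + s)) ^ 2 * Complex.normSq y :=
        mul_le_mul_of_nonneg_left h2 (sq_nonneg _)
      have h4 : 0 ≤ (Complex.normSq w * (a - b) - k * (1 + s) * r) ^ 2 / Complex.normSq w := by positivity
      have h5 : (Complex.normSq w * (a - b) - k * (1 + s) * r) ^ 2 / Complex.normSq w
        = Complex.normSq w * (a - b) ^ 2 - 2 * (k * (1 + s)) * r * (a - b) + (k * (1 + s)) ^ 2 * (r ^ 2 / Complex.normSq w) := by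
        field_simp
        ring
      linarith




section matInt
variable {α : Type*} [MeasurableSpace α] {d : ℕ} {μ : Measure α} {G : α → Mat d}

theorem rtr_mul_eq (A B : Mat d) : rtr (A * B) = ∑ i, ∑ j, (A i j * B j i).re := by
  simp [rtr, Matrix.trace, Matrix.mul_apply]

theorem rtr_mul_comm (A B : Mat d) : rtr (A * B) = rtr (B * A) := by
  unfold rtr; rw [Matrix.trace_mul_comm]

theorem integrable_rtr_mul (hG : ∀ i j, Integrable (fun a => G a i j) μ) (A : Mat d) :
    Integrable (fun a => rtr (A * G a)) μ := by
  simp only [rtr_mul_eq]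
  exact integrable_finsetSum _ fun i _ => integrable_finsetSum _ fun j _ =>
    ((hG j i).const_mul (A i j)).re

theorem rtr_mul_matInt (hG : ∀ i j, Integrable (fun a => G a i j) μ) (A : Mat d) :
    rtr (A * matInt μ G) = ∫ a, rtr (A * G a) ∂μ := by
  simp only [rtr_mul_eq]
  have h : ∀ i j, Integrable (fun a => (A i j * G a j i).re) μ := fun i j =>
    ((hG j i).const_mul (A i j)).re
  rw [integral_finsetSum _ fun i _ => integrable_finsetSum _ fun j _ => h i j]
  refine Finset.sum_congr rfl fun i _ => ?_
  rw [integral_finsetSum _ fun j _ => h i j]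
  refine Finset.sum_congr rfl fun j _ => ?_
  have h2 := integral_re ((hG j i).const_mul (A i j))
  simp only [matInt, Matrix.of_apply]
  rw [← integral_const_mul]
  exact h2.symm

theorem rtr_matInt (hG : ∀ i j, Integrable (fun a => G a i j) μ) :
    rtr (matInt μ G) = ∫ a, rtr (G a) ∂μ := by
  have := rtr_mul_matInt hG 1
  simpa using this

end matInt

section
variable {d : ℕ}

theorem eig_cond {A B : Mat d} (hA : A.PosSemidef) (hB : B.PosSemidef)
    (h : B.PosDef ∨ A = 0) (i j : Fin d) : hB.1.eigenvalues j = 0 → hA.1.eigenvalues i = 0 := by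
  intro h0
  rcases h with h | h
  · exact absurd h0 (h.eigenvalues_pos j).ne'
  · have := (hA.1.eigenvalues_eq_zero_iff).2 h
    rw [this]; rfl

theorem relD_sum {A B U V : Mat d} (hA : A.PosSemidef) (hB : B.PosSemidef)
    (hU : U.conjTranspose * U = 1) (hU' : U * U.conjTranspose = 1)
    (hV : V.conjTranspose * V = 1) (hV' : V * V.conjTranspose = 1)
    (hAU : A = U * Matrix.diagonal (fun i => (hA.1.eigenvalues i : ℂ)) * U.conjTranspose)
    (hBV : ∀ f : ℝ → ℝ, cfc f B = V * Matrix.diagonal (fun i => (f (hB.1.eigenvalues i) : ℂ)) * V.conjTranspose)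
    (h : B.PosDef ∨ A = 0) :
    IntegrableOn (fun s => ∑ i, ∑ j, Complex.normSq ((U.conjTranspose * V) i j) *
      psiS (hA.1.eigenvalues i) (hB.1.eigenvalues j) s) (Set.Ioi 0) ∧
    relD A B - rtr A + rtr B = ∫ s in Set.Ioi 0, ∑ i, ∑ j, Complex.normSq ((U.conjTranspose * V) i j) *
      psiS (hA.1.eigenvalues i) (hB.1.eigenvalues j) s := by
  obtain ⟨s1, s2⟩ := unitary_sums U V hU hU' hV hV'
  have hp := fun i j => psiS_integral (hA.eigenvalues_nonneg i) (hB.eigenvalues_nonneg j)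
    (eig_cond hA hB h i j)
  have hi : ∀ i j, IntegrableOn (fun s => Complex.normSq ((U.conjTranspose * V) i j) *
      psiS (hA.1.eigenvalues i) (hB.1.eigenvalues j) s) (Set.Ioi 0) := fun i j =>
    (hp i j).1.const_mul _
  refine ⟨integrable_finsetSum _ fun i _ => integrable_finsetSum _ fun j _ => hi i j, ?_⟩
  rw [integral_finsetSum _ fun i _ => integrable_finsetSum _ fun j _ => hi i j]
  have e : ∀ i, ∫ s in Set.Ioi 0, ∑ j, Complex.normSq ((U.conjTranspose * V) i j) *
      psiS (hA.1.eigenvalues i) (hB.1.eigenvalues j) s = ∑ j, Complex.normSq ((U.conjTranspose * V) i j) *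
      (hA.1.eigenvalues i * Real.log (hA.1.eigenvalues i) -
        hA.1.eigenvalues i * Real.log (hB.1.eigenvalues j) - hA.1.eigenvalues i + hB.1.eigenvalues j) := by
    intro i
    rw [integral_finsetSum _ fun j _ => hi i j]
    refine Finset.sum_congr rfl fun j _ => ?_
    rw [integral_const_mul, (hp i j).2]
  simp only [e]
  have e2 : rtr (A * mlog B) = ∑ i, ∑ j, Complex.normSq ((U.conjTranspose * V) i j) *
      (hA.1.eigenvalues i * Real.log (hB.1.eigenvalues j)) := by
    rw [mlog, hBV Real.log]
    nth_rewrite 1 [hAU]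
    exact trace_two U V _ _
  have e3 : vnEnt A = ∑ i, ∑ j, Complex.normSq ((U.conjTranspose * V) i j) *
      (-(hA.1.eigenvalues i * Real.log (hA.1.eigenvalues i))) := by
    rw [vnEnt_eq hA.1]
    refine Finset.sum_congr rfl fun i _ => ?_
    rw [← Finset.sum_mul, s1 i, one_mul, Real.negMulLog, neg_mul]
  have e4 : rtr A = ∑ i, ∑ j, Complex.normSq ((U.conjTranspose * V) i j) * (hA.1.eigenvalues i) := by
    rw [rtr_eq hA.1]
    refine Finset.sum_congr rfl fun i _ => ?_
    rw [← Finset.sum_mul, s1 i, one_mul]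
  have e5 : rtr B = ∑ i, ∑ j, Complex.normSq ((U.conjTranspose * V) i j) * (hB.1.eigenvalues j) := by
    rw [rtr_eq hB.1, Finset.sum_comm]
    refine Finset.sum_congr rfl fun i _ => ?_
    rw [← Finset.sum_mul, s2 i, one_mul]
  rw [relD, e2, e3, e4, e5]
  simp only [← Finset.sum_neg_distrib, ← Finset.sum_sub_distrib, ← Finset.sum_add_distrib]
  refine Finset.sum_congr rfl fun i _ => Finset.sum_congr rfl fun j _ => ?_
  ring

theorem relD_ge {A B : Mat d} (hA : A.PosSemidef) (hB : B.PosSemidef) (h : B.PosDef ∨ A = 0)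
    (Δ : ℝ → Mat d) (hIntg : IntegrableOn (fun s => ell s (Δ s) A B) (Set.Ioi 0)) :
    ∫ s in Set.Ioi 0, ell s (Δ s) A B ≤ relD A B - rtr A + rtr B := by
  obtain ⟨U, hU, hU', _, hAU⟩ := herm_decomp hA.1
  obtain ⟨V, hV, hV', hBf, hBV⟩ := herm_decomp hB.1
  obtain ⟨h1, h2⟩ := relD_sum hA hB hU hU' hV hV' hAU hBf h
  rw [h2]
  refine setIntegral_mono_on hIntg h1 measurableSet_Ioi fun s hs => ?_
  have e : Δ s = V * (V.conjTranspose * Δ s * U) * U.conjTranspose := by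
    simp only [Matrix.mul_assoc]
    rw [hU', Matrix.mul_one, ← Matrix.mul_assoc, hV', Matrix.one_mul]
  have := ell_eq s U V (V.conjTranspose * Δ s * U) hA.1.eigenvalues hB.1.eigenvalues hU hV
  rw [← e, ← hAU, ← hBV] at this
  rw [this]
  exact Finset.sum_le_sum fun i _ => Finset.sum_le_sum fun j _ =>
    ell_scalar hs (hA.eigenvalues_nonneg i) (hB.eigenvalues_nonneg j) _ _

theorem r_bound {a b s : ℝ} (ha : 0 < a) (hb : 0 < b) (hs : 0 < s) :
    |(a - b) / ((b + s * a) * (1 + s))| ≤ (|a - b| / min a b) / (1 + s) ^ 2 := by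
  have hm : 0 < min a b := lt_min ha hb
  rw [abs_div, abs_of_pos (show 0 < (b + s * a) * (1 + s) by positivity), div_div]
  apply div_le_div_of_nonneg_left (abs_nonneg _) (by positivity)
  rw [pow_two, ← mul_assoc]
  apply mul_le_mul_of_nonneg_right _ (by positivity)
  have h1 := min_le_left a b
  have h2 := min_le_right a b
  nlinarith

theorem relD_exists {C D : Mat d} (hC : C.PosDef) (hD : D.PosDef) :
    ∃ Δ : ℝ → Mat d, (∀ i j, Measurable fun s => Δ s i j) ∧
      (∃ K, 0 ≤ K ∧ ∀ s, 0 < s → ∀ i j, ‖Δ s i j‖ ≤ K / (1 + s) ^ 2) ∧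
      relD C D - rtr C + rtr D = ∫ s in Set.Ioi 0, ell s (Δ s) C D := by
  have hA := hC.posSemidef
  have hB := hD.posSemidef
  obtain ⟨U, hU, hU', _, hAU⟩ := herm_decomp hA.1
  obtain ⟨V, hV, hV', hBf, hBV⟩ := herm_decomp hB.1
  obtain ⟨h1, h2⟩ := relD_sum hA hB hU hU' hV hV' hAU hBf (Or.inl hD)
  set W := U.conjTranspose * V with hW
  let r : ℝ → Fin d → Fin d → ℝ := fun s i j =>
    (hA.1.eigenvalues i - hB.1.eigenvalues j) /
      ((hB.1.eigenvalues j + s * hA.1.eigenvalues i) * (1 + s))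
  let y : ℝ → Mat d := fun s => Matrix.of fun j i => star (W i j) * (r s i j : ℂ)
  have hr : ∀ i j, Measurable fun s => r s i j := by
    intro i j
    simp only [r]
    fun_prop
  refine ⟨fun s => V * y s * U.conjTranspose, ?_, ?_, ?_⟩
  · intro i j
    simp only [Matrix.mul_apply, y, Matrix.of_apply]
    refine Finset.measurable_sum _ fun k _ => Measurable.mul_const ?_ _
    refine Finset.measurable_sum _ fun l _ => Measurable.const_mul ?_ _
    refine Measurable.const_mul ?_ _
    exact Complex.measurable_ofReal.comp (hr _ _)
  · let m : Fin d → Fin d → ℝ := fun i j => |hA.1.eigenvalues i - hB.1.eigenvalues j| /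
      min (hA.1.eigenvalues i) (hB.1.eigenvalues j)
    have hm : ∀ i j, 0 ≤ m i j := fun i j => div_nonneg (abs_nonneg _)
      (le_min (hA.eigenvalues_nonneg _) (hB.eigenvalues_nonneg _))
    let q : Fin d → Fin d → ℝ := fun i j => ∑ k, ∑ l, ‖V i l‖ * (‖W k l‖ * m k l) * ‖U.conjTranspose k j‖
    have hq : ∀ i j, 0 ≤ q i j := fun i j => Finset.sum_nonneg fun k _ => Finset.sum_nonneg fun l _ => by
      have := hm k l; positivity
    refine ⟨∑ i, ∑ j, q i j, Finset.sum_nonneg fun i _ => Finset.sum_nonneg fun j _ => hq i j, ?_⟩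
    intro s hs i j
    have b1 : ‖(V * y s * U.conjTranspose) i j‖ ≤ q i j / (1 + s) ^ 2 := by
      simp only [Matrix.mul_apply (M := V * y s), Matrix.mul_apply (M := V), q, Finset.sum_mul,
        Finset.sum_div]
      refine (norm_sum_le _ _).trans (Finset.sum_le_sum fun k _ => ?_)
      refine (norm_sum_le _ _).trans (Finset.sum_le_sum fun l _ => ?_)
      rw [norm_mul, norm_mul, mul_div_right_comm]
      refine mul_le_mul_of_nonneg_right ?_ (norm_nonneg _)
      rw [mul_div_assoc]
      refine mul_le_mul_of_nonneg_left ?_ (norm_nonneg _)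
      simp only [y, Matrix.of_apply, norm_mul, norm_star]
      rw [mul_div_assoc]
      refine mul_le_mul_of_nonneg_left ?_ (norm_nonneg _)
      rw [Complex.norm_real]
      exact r_bound (hC.eigenvalues_pos k) (hD.eigenvalues_pos l) hs
    refine b1.trans ?_
    gcongr
    exact (Finset.single_le_sum (fun j _ => hq i j) (Finset.mem_univ j)).trans
      (Finset.single_le_sum (f := fun i => ∑ j, q i j) (fun i _ => Finset.sum_nonneg fun j _ => hq i j) (Finset.mem_univ i))
  · rw [h2]
    refine setIntegral_congr_fun measurableSet_Ioi fun s hs => ?_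
    have hs0 : 0 < s := hs
    have := ell_eq s U V (y s) hA.1.eigenvalues hB.1.eigenvalues hU hV
    rw [← hAU, ← hBV] at this
    simp only
    rw [this]
    refine Finset.sum_congr rfl fun i _ => Finset.sum_congr rfl fun j _ => ?_
    have ha := hC.eigenvalues_pos i
    have hb := hD.eigenvalues_pos j
    rw [← hW]
    have n1 : (y s j i * W i j).re = Complex.normSq (W i j) * r s i j := by
      simp [y, Complex.normSq_apply]; ring
    have n2 : Complex.normSq (y s j i) = Complex.normSq (W i j) * r s i j ^ 2 := by
      simp [y, Complex.normSq_mul, Complex.normSq_ofReal]; left; ring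
    rw [n1, n2]
    simp only [r, psiS]
    field_simp
    ring

open Matrix in
theorem exists_tangent {C D : Mat d} (hC : C.PosDef) (hD : D.PosDef) :
    ∃ H K : Mat d, (∀ A B : Mat d, A.PosSemidef → B.PosSemidef → (B.PosDef ∨ A = 0) →
      rtr (H * A) + rtr (K * B) + rtr A - rtr B ≤ relD A B) ∧
      relD C D = rtr (H * C) + rtr (K * D) + rtr C - rtr D := by
  obtain ⟨Δ, hm, ⟨κ, hκ0, hκ⟩, hΔ⟩ := relD_exists hC hD
  let Hs : ℝ → Mat d := fun s => ((2 / (1 + s) : ℝ) : ℂ) • (Δ s)ᴴ - (s : ℂ) • ((Δ s)ᴴ * Δ s)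
  let Ks : ℝ → Mat d := fun s => -(((2 / (1 + s) : ℝ) : ℂ) • (Δ s)ᴴ) - (Δ s * (Δ s)ᴴ)
  have hell : ∀ s A B, ell s (Δ s) A B = rtr (A * Hs s) + rtr (B * Ks s) := by
    intro s A B
    have t1 : rtr ((Δ s)ᴴ * B * Δ s) = rtr (B * (Δ s * (Δ s)ᴴ)) := by
      rw [rtr_mul_comm, ← Matrix.mul_assoc, rtr_mul_comm]
    have t2 : rtr (Δ s * A * (Δ s)ᴴ) = rtr (A * ((Δ s)ᴴ * Δ s)) := by
      rw [rtr_mul_comm, ← Matrix.mul_assoc, rtr_mul_comm]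
    have t3 : rtr ((Δ s)ᴴ * (A - B)) = rtr (A * (Δ s)ᴴ) - rtr (B * (Δ s)ᴴ) := by
      rw [rtr_mul_comm, Matrix.sub_mul, rtr, Matrix.trace_sub, Complex.sub_re]; rfl
    rw [ell, t1, t2, t3]
    have u1 : rtr (A * Hs s) = 2 / (1 + s) * rtr (A * (Δ s)ᴴ) - s * rtr (A * ((Δ s)ᴴ * Δ s)) := by
      simp only [Hs, rtr, Matrix.mul_sub, Matrix.trace_sub, Matrix.mul_smul, Matrix.trace_smul,
        Complex.sub_re, smul_eq_mul, Complex.re_ofReal_mul]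
    have u2 : rtr (B * Ks s) = -(2 / (1 + s) * rtr (B * (Δ s)ᴴ)) - rtr (B * (Δ s * (Δ s)ᴴ)) := by
      simp only [Ks, rtr, Matrix.mul_sub, Matrix.trace_sub, Matrix.mul_smul, Matrix.trace_smul,
        Matrix.mul_neg, Matrix.trace_neg, Complex.neg_re,
        Complex.sub_re, smul_eq_mul, Complex.re_ofReal_mul]
    rw [u1, u2]; ring
  have hmH : ∀ i j, Measurable fun s => (Δ s)ᴴ i j := fun i j => by
    simp only [Matrix.conjTranspose_apply]
    exact Complex.continuous_conj.measurable.comp (hm j i)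
  have base : IntegrableOn (fun s : ℝ => 1 / (1 + s) ^ 2) (Set.Ioi 0) := by
    have := (psiS_integral (a := 0) (b := 1) le_rfl zero_le_one (by simp)).1
    refine this.congr_fun (fun s _ => ?_) measurableSet_Ioi
    simp [psiS]
  have bd : ∀ (f : ℝ → ℂ) (κ' : ℝ), Measurable f → (∀ s, 0 < s → ‖f s‖ ≤ κ' * (1 / (1 + s) ^ 2)) →
      IntegrableOn f (Set.Ioi 0) := by
    intro f κ' hf hb
    refine Integrable.mono' (base.const_mul κ') hf.aestronglyMeasurable ?_
    exact (ae_restrict_mem measurableSet_Ioi).mono fun s hs => hb s hs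
  have i1 : ∀ i j, IntegrableOn (fun s => ((2 / (1 + s) : ℝ) : ℂ) * (Δ s)ᴴ i j) (Set.Ioi 0) := by
    intro i j
    refine bd _ (2 * κ) ((Complex.measurable_ofReal.comp (by fun_prop)).mul (hmH i j)) fun s hs => ?_
    rw [norm_mul, Complex.norm_real, Matrix.conjTranspose_apply, norm_star, mul_assoc]
    refine mul_le_mul ?_ ?_ (norm_nonneg _) (by norm_num)
    · rw [Real.norm_eq_abs, abs_of_pos (by positivity), div_le_iff₀ (by positivity)]; linarith
    · rw [mul_one_div]; exact hκ s hs j i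
  have pb : ∀ s, 0 < s → ∀ i j k l, ‖Δ s i j‖ * ‖Δ s k l‖ ≤ κ ^ 2 * (1 / (1 + s) ^ 4) := by
    intro s hs i j k l
    have := mul_le_mul (hκ s hs i j) (hκ s hs k l) (norm_nonneg _) (by positivity)
    refine this.trans (le_of_eq ?_)
    field_simp
  have i2 : ∀ i j, IntegrableOn (fun s : ℝ => (s : ℂ) * ((Δ s)ᴴ * Δ s) i j) (Set.Ioi 0) := by
    intro i j
    simp only [Matrix.mul_apply, Finset.mul_sum]
    refine integrable_finsetSum _ fun k _ => ?_
    refine bd _ (κ ^ 2) (Complex.measurable_ofReal.mul ((hmH i k).mul (hm k j))) fun s hs => ?_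
    rw [norm_mul, norm_mul, Complex.norm_real, Matrix.conjTranspose_apply, norm_star,
      Real.norm_eq_abs, abs_of_pos hs]
    refine (mul_le_mul_of_nonneg_left (pb s hs _ _ _ _) hs.le).trans ?_
    rw [mul_left_comm]
    refine mul_le_mul_of_nonneg_left ?_ (by positivity)
    rw [mul_one_div, div_le_div_iff₀ (by positivity) (by positivity)]
    have : s ≤ (1 + s) ^ 2 := by nlinarith
    calc s * (1 + s) ^ 2 ≤ (1 + s) ^ 2 * (1 + s) ^ 2 := by gcongr
      _ = _ := by ring
  have i3 : ∀ i j, IntegrableOn (fun s => (Δ s * (Δ s)ᴴ) i j) (Set.Ioi 0) := by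
    intro i j
    simp only [Matrix.mul_apply]
    refine integrable_finsetSum _ fun k _ => ?_
    refine bd _ (κ ^ 2) ((hm i k).mul (hmH k j)) fun s hs => ?_
    rw [norm_mul, Matrix.conjTranspose_apply, norm_star]
    refine (pb s hs _ _ _ _).trans ?_
    refine mul_le_mul_of_nonneg_left ?_ (by positivity)
    apply one_div_le_one_div_of_le (by positivity)
    exact pow_le_pow_right₀ (by linarith) (by norm_num)
  have iH : ∀ i j, Integrable (fun s => Hs s i j) (volume.restrict (Set.Ioi 0)) := by
    intro i j
    simp only [Hs, Matrix.sub_apply, Matrix.smul_apply, smul_eq_mul]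
    exact (i1 i j).sub (i2 i j)
  have iK : ∀ i j, Integrable (fun s => Ks s i j) (volume.restrict (Set.Ioi 0)) := by
    intro i j
    simp only [Ks, Matrix.sub_apply, Matrix.smul_apply, smul_eq_mul, Matrix.neg_apply]
    exact (i1 i j).neg.sub (i3 i j)
  have hIntg : ∀ A B : Mat d, IntegrableOn (fun s => ell s (Δ s) A B) (Set.Ioi 0) ∧
      ∫ s in Set.Ioi 0, ell s (Δ s) A B =
        rtr (matInt (volume.restrict (Set.Ioi 0)) Hs * A) + rtr (matInt (volume.restrict (Set.Ioi 0)) Ks * B) := by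
    intro A B
    have j1 := integrable_rtr_mul iH A
    have j2 := integrable_rtr_mul iK B
    simp only [hell]
    refine ⟨j1.add j2, ?_⟩
    rw [integral_add j1 j2, rtr_mul_comm, rtr_mul_matInt iH, rtr_mul_comm _ B, rtr_mul_matInt iK]
  refine ⟨matInt (volume.restrict (Set.Ioi 0)) Hs, matInt (volume.restrict (Set.Ioi 0)) Ks, ?_, ?_⟩
  · intro A B hA hB h
    have := relD_ge hA hB h Δ (hIntg A B).1
    rw [(hIntg A B).2] at this
    linarith
  · rw [(hIntg C D).2] at hΔ
    linarith

end




open scoped Matrix.Norms.L2Operator in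
theorem continuous_cfc_herm {d : ℕ} {f : ℝ → ℝ} (hf : Continuous f) :
    Continuous (fun v : {v : Fin d → Fin d → ℂ // (Matrix.of v : Mat d).IsHermitian} =>
      (cfc f (Matrix.of v.1 : Mat d))) := by
  refine Continuous.cfc_of_mem_nhdsSet (s := Set.univ) (A := Mat d) (p := IsSelfAdjoint) f (by simp) ?_ (fun x => x.2) hf.continuousOn
  exact continuous_subtype_val

section
variable {α : Type*} [MeasurableSpace α] {d : ℕ}

theorem measurable_cfc {f : ℝ → ℝ} (hf : Continuous f) {B : α → Mat d}
    (hm : ∀ i j, Measurable fun a => B a i j) (hB : ∀ a, (B a).IsHermitian) (i j : Fin d) :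
    Measurable fun a => (cfc f (B a)) i j := by
  have h1 : Measurable fun a => (⟨fun i j => B a i j, hB a⟩ : {v : Fin d → Fin d → ℂ // (Matrix.of v : Mat d).IsHermitian}) :=
    Measurable.subtype_mk (measurable_pi_lambda _ fun i => measurable_pi_lambda _ fun j => hm i j)
  have h2 : Continuous (fun v : {v : Fin d → Fin d → ℂ // (Matrix.of v : Mat d).IsHermitian} =>
      (cfc f (Matrix.of v.1 : Mat d)) i j) :=
    (continuous_apply_apply i j).comp (continuous_cfc_herm hf)
  exact h2.measurable.comp h1

open Matrix in
theorem vnEnt_cfc {A : Mat d} (hA : A.IsHermitian) : vnEnt A = rtr (cfc Real.negMulLog A) := by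
  obtain ⟨U, h1, h2, h3, h4⟩ := herm_decomp hA
  rw [h3, rtr_mul_comm, ← Matrix.mul_assoc, h1, Matrix.one_mul, vnEnt_eq hA]
  simp [rtr, Matrix.trace]

theorem measurable_vnEnt {B : α → Mat d}
    (hm : ∀ i j, Measurable fun a => B a i j) (hB : ∀ a, (B a).IsHermitian) :
    Measurable fun a => vnEnt (B a) := by
  simp only [fun a => vnEnt_cfc (hB a), rtr, Matrix.trace, Matrix.diag, Complex.re_sum]
  refine Finset.measurable_sum _ fun i _ => ?_
  exact Complex.measurable_re.comp (measurable_cfc Real.continuous_negMulLog hm hB i i)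

theorem measurable_mlog {B : α → Mat d}
    (hm : ∀ i j, Measurable fun a => B a i j) (hB : ∀ a, (B a).IsHermitian) (i j : Fin d) :
    Measurable fun a => mlog (B a) i j := by
  let f : ℕ → ℝ → ℝ := fun n x => min (n * |x|) 1 * Real.log (max |x| (1 / (n + 1)))
  have hf : ∀ n, Continuous (f n) := by
    intro n
    refine Continuous.mul (by fun_prop) (Continuous.log (by fun_prop) fun x => ?_)
    have : (0 : ℝ) < 1 / (n + 1) := by positivity
    exact (lt_of_lt_of_le this (le_max_right _ _)).ne'
  have hl : ∀ x, Tendsto (fun n => f n x) atTop (𝓝 (Real.log x)) := by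
    intro x
    by_cases hx : x = 0
    · simp [f, hx]
    have hx' : 0 < |x| := abs_pos.2 hx
    obtain ⟨N, hN⟩ := exists_nat_gt (1 / |x|)
    refine tendsto_const_nhds.congr' ?_
    filter_upwards [eventually_ge_atTop N] with n hn
    have hn' : 1 / |x| < n := hN.trans_le (by exact_mod_cast hn)
    have h1 : 1 < n * |x| := by rwa [div_lt_iff₀ hx'] at hn'
    have h2 : (1 : ℝ) / (n + 1) ≤ |x| := by
      rw [div_le_iff₀ (by positivity)]; nlinarith
    simp only [f, min_eq_right h1.le, max_eq_left h2, one_mul, Real.log_abs]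
  refine measurable_of_tendsto_metrizable (fun n => measurable_cfc (hf n) hm hB i j) ?_
  rw [tendsto_pi_nhds]
  intro a
  obtain ⟨U, h1, h2, h3, h4⟩ := herm_decomp (hB a)
  simp only [mlog, h3]
  simp only [Matrix.mul_apply (M := U * _), Matrix.mul_diagonal]
  refine tendsto_finsetSum _ fun k _ => ?_
  refine Tendsto.mul ?_ tendsto_const_nhds
  refine Tendsto.mul tendsto_const_nhds ?_
  exact (Complex.continuous_ofReal.tendsto _).comp (hl _)
end




section
open Matrix
variable {d : ℕ}

theorem eig_multiset {U : Mat d} (hU : Uᴴ * U = 1) {a : Fin d → ℝ} {A : Mat d}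
    (hA : A = U * diagonal (fun i => (a i : ℂ)) * Uᴴ) (hH : A.IsHermitian) :
    Multiset.map hH.eigenvalues Finset.univ.val = Multiset.map a Finset.univ.val := by
  have h1 : A.charpoly = ∏ i, (Polynomial.X - Polynomial.C (a i : ℂ)) := by
    rw [hA, charpoly_mul_comm, ← Matrix.mul_assoc, hU, Matrix.one_mul, charpoly_diagonal]
  have h2 := hH.roots_charpoly_eq_eigenvalues
  have h0 : (∏ i, (Polynomial.X - Polynomial.C (a i : ℂ))).roots =
      Multiset.map (fun i => (a i : ℂ)) Finset.univ.val := by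
    have := Polynomial.roots_multiset_prod_X_sub_C (Multiset.map (fun i => (a i : ℂ)) Finset.univ.val)
    rw [Multiset.map_map] at this
    exact this
  rw [h1, h0] at h2
  have h3 := congrArg (Multiset.map Complex.re) h2
  simpa [Multiset.map_map, Function.comp_def] using h3.symm

theorem herm_of_diag {U : Mat d} {a : Fin d → ℝ} {A : Mat d}
    (hA : A = U * diagonal (fun i => (a i : ℂ)) * Uᴴ) : A.IsHermitian := by
  rw [hA, IsHermitian, conjTranspose_mul, conjTranspose_mul, conjTranspose_conjTranspose,
    diagonal_conjTranspose, Matrix.mul_assoc]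
  congr 3
  ext i; simp

theorem vnEnt_diag {U : Mat d} (hU : Uᴴ * U = 1) {a : Fin d → ℝ} {A : Mat d}
    (hA : A = U * diagonal (fun i => (a i : ℂ)) * Uᴴ) : vnEnt A = ∑ i, Real.negMulLog (a i) := by
  have h := eig_multiset hU hA (herm_of_diag hA)
  rw [vnEnt_eq (herm_of_diag hA)]
  have := congrArg (fun m => (Multiset.map Real.negMulLog m).sum) h
  simpa [Multiset.map_map, Function.comp_def, Finset.sum] using this

theorem eig_diag {U : Mat d} (hU : Uᴴ * U = 1) {a : Fin d → ℝ} {A : Mat d}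
    (hA : A = U * diagonal (fun i => (a i : ℂ)) * Uᴴ) (hH : A.IsHermitian) (i : Fin d) :
    ∃ k, hH.eigenvalues i = a k := by
  have h := eig_multiset hU hA hH
  have h1 : hH.eigenvalues i ∈ Multiset.map hH.eigenvalues Finset.univ.val :=
    Multiset.mem_map_of_mem _ (Finset.mem_univ i)
  rw [h, Multiset.mem_map] at h1
  obtain ⟨k, _, hk⟩ := h1
  exact ⟨k, hk.symm⟩

theorem rtr_nonneg {A : Mat d} (hA : A.PosSemidef) : 0 ≤ rtr A := by
  rw [rtr_eq hA.1]; exact Finset.sum_nonneg fun i _ => hA.eigenvalues_nonneg i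

theorem eig_le {A : Mat d} (hA : A.PosSemidef) (i : Fin d) : hA.1.eigenvalues i ≤ rtr A := by
  rw [rtr_eq hA.1]
  exact Finset.single_le_sum (fun i _ => hA.eigenvalues_nonneg i) (Finset.mem_univ i)

theorem eq_zero_of_rtr {A : Mat d} (hA : A.PosSemidef) (h : rtr A = 0) : A = 0 := by
  rw [← hA.1.eigenvalues_eq_zero_iff]
  ext i
  have := eig_le hA i
  exact le_antisymm (by simpa [h] using this) (hA.eigenvalues_nonneg i)

theorem entry_le {A : Mat d} (hA : A.PosSemidef) (i j : Fin d) : ‖A i j‖ ≤ rtr A := by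
  obtain ⟨U, h1, h2, h3, h4⟩ := herm_decomp hA.1
  have hU : ∀ i k, ‖U i k‖ ≤ 1 := by
    intro i k
    have h := congrArg Complex.re (congrFun (congrFun h2 i) i)
    simp only [Matrix.mul_apply, conjTranspose_apply, Complex.re_sum, one_apply_eq, Complex.one_re] at h
    have h' : ∀ k, (U i k * star (U i k)).re = ‖U i k‖ ^ 2 := fun k => by
      rw [Complex.star_def, Complex.mul_conj, Complex.normSq_eq_norm_sq]; simp [← Complex.ofReal_pow]
    simp only [h'] at h
    have : ‖U i k‖ ^ 2 ≤ 1 := by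
      rw [← h]; exact Finset.single_le_sum (f := fun k => ‖U i k‖ ^ 2) (fun k _ => sq_nonneg _) (Finset.mem_univ k)
    nlinarith [norm_nonneg (U i k)]
  have : A i j = ∑ k, U i k * (hA.1.eigenvalues k : ℂ) * star (U j k) := by
    conv_lhs => rw [h4]
    simp only [Matrix.mul_apply (M := U * _), Matrix.mul_diagonal, conjTranspose_apply]
  rw [this, rtr_eq hA.1]
  refine (norm_sum_le _ _).trans (Finset.sum_le_sum fun k _ => ?_)
  rw [norm_mul, norm_mul, norm_star, Complex.norm_real, Real.norm_eq_abs,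
    abs_of_nonneg (hA.eigenvalues_nonneg k)]
  have hn := hA.eigenvalues_nonneg k
  calc _ ≤ 1 * hA.1.eigenvalues k * 1 := by
        gcongr
        · exact hU i k
        · exact hU j k
    _ = _ := by ring

theorem vnEnt_bound {A : Mat d} (hA : A.PosSemidef) :
    |vnEnt A + rtr A * Real.log (rtr A)| ≤ d * rtr A := by
  have h : vnEnt A + rtr A * Real.log (rtr A) =
      ∑ i, (hA.1.eigenvalues i * Real.log (rtr A) - hA.1.eigenvalues i * Real.log (hA.1.eigenvalues i)) := by
    rw [vnEnt_eq hA.1, Finset.sum_sub_distrib, ← Finset.sum_mul, ← rtr_eq hA.1]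
    simp [Real.negMulLog, Finset.sum_neg_distrib]; ring
  have hb : ∀ i, 0 ≤ (hA.1.eigenvalues i * Real.log (rtr A) - hA.1.eigenvalues i * Real.log (hA.1.eigenvalues i)) ∧
     (hA.1.eigenvalues i * Real.log (rtr A) - hA.1.eigenvalues i * Real.log (hA.1.eigenvalues i)) ≤ rtr A := by
    intro i
    have h0 := hA.eigenvalues_nonneg i
    have h1 := eig_le hA i
    set l := hA.1.eigenvalues i
    rcases h0.eq_or_lt with h0 | h0
    · rw [← h0]; simpa using rtr_nonneg hA
    have h2 : 0 < rtr A := h0.trans_le h1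
    rw [← mul_sub, ← Real.log_div h2.ne' h0.ne']
    constructor
    · exact mul_nonneg h0.le (Real.log_nonneg ((one_le_div h0).2 h1))
    · have := Real.log_le_sub_one_of_pos (div_pos h2 h0)
      calc l * Real.log (rtr A / l) ≤ l * (rtr A / l - 1) := by gcongr
        _ = rtr A - l := by field_simp
        _ ≤ rtr A := by linarith
  rw [h, abs_of_nonneg (Finset.sum_nonneg fun i _ => (hb i).1)]
  refine (Finset.sum_le_sum fun i _ => (hb i).2).trans ?_
  simp

theorem rtr_smul (c : ℝ) (A : Mat d) : rtr ((c : ℂ) • A) = c * rtr A := by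
  simp [rtr, trace_smul]

theorem psd_smul {c : ℝ} (hc : 0 ≤ c) {A : Mat d} (hA : A.PosSemidef) : ((c : ℂ) • A).PosSemidef :=
  hA.smul (by exact_mod_cast hc)

theorem vnEnt_smul {c : ℝ} (hc : 0 ≤ c) {A : Mat d} (hA : A.PosSemidef) :
    vnEnt ((c : ℂ) • A) = c * vnEnt A - c * Real.log c * rtr A := by
  obtain ⟨U, h1, h2, h3, h4⟩ := herm_decomp hA.1
  have : (c : ℂ) • A = U * diagonal (fun i => ((c * hA.1.eigenvalues i : ℝ) : ℂ)) * Uᴴ := by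
    conv_lhs => rw [h4]
    rw [← Matrix.smul_mul, ← Matrix.mul_smul, ← diagonal_smul]
    congr; ext i; simp
  rw [vnEnt_diag h1 this, vnEnt_eq hA.1, rtr_eq hA.1, Finset.mul_sum, Finset.mul_sum, ← Finset.sum_sub_distrib]
  refine Finset.sum_congr rfl fun i _ => ?_
  rw [Real.negMulLog_mul]
  simp only [Real.negMulLog]; ring

/-- regularisation -/
def reg (ε : ℝ) (A : Mat d) : Mat d := A + ((ε * rtr A : ℝ) : ℂ) • 1

theorem reg_diag (ε : ℝ) {A U : Mat d} (hA : A.PosSemidef) (h2 : U * Uᴴ = 1)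
    (h4 : A = U * diagonal (fun i => (hA.1.eigenvalues i : ℂ)) * Uᴴ) :
    reg ε A = U * diagonal (fun i => ((hA.1.eigenvalues i + ε * rtr A : ℝ) : ℂ)) * Uᴴ := by
  have : diagonal (fun i => ((hA.1.eigenvalues i + ε * rtr A : ℝ) : ℂ)) =
      diagonal (fun i => ((hA.1.eigenvalues i : ℝ) : ℂ)) + ((ε * rtr A : ℝ) : ℂ) • (1 : Mat d) := by
    rw [smul_one_eq_diagonal, diagonal_add]; simp
  rw [this, Matrix.mul_add, Matrix.add_mul, ← h4, Matrix.mul_smul, Matrix.smul_mul, Matrix.mul_one, h2, reg]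

theorem reg_psd {ε : ℝ} (hε : 0 ≤ ε) {A : Mat d} (hA : A.PosSemidef) : (reg ε A).PosSemidef :=
  hA.add (psd_smul (mul_nonneg hε (rtr_nonneg hA)) PosSemidef.one)

theorem reg_posDef {ε : ℝ} (hε : 0 < ε) {A : Mat d} (hA : A.PosSemidef) (h : 0 < rtr A) :
    (reg ε A).PosDef := by
  refine PosDef.posSemidef_add hA (PosDef.smul PosDef.one ?_)
  exact_mod_cast mul_pos hε h

theorem rtr_reg (ε : ℝ) (A : Mat d) : rtr (reg ε A) = (1 + d * ε) * rtr A := by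
  simp [rtr, reg, trace_add, trace_smul]; ring

theorem reg_zero_mat (ε : ℝ) : reg ε (0 : Mat d) = 0 := by simp [reg, rtr]

theorem vnEnt_reg (ε : ℝ) {A : Mat d} (hA : A.PosSemidef) :
    vnEnt (reg ε A) = ∑ i, Real.negMulLog (hA.1.eigenvalues i + ε * rtr A) := by
  obtain ⟨U, h1, h2, h3, h4⟩ := herm_decomp hA.1
  exact vnEnt_diag h1 (reg_diag ε hA h2 h4)

theorem vnEnt_reg_tendsto {A : Mat d} (hA : A.PosSemidef) :
    Tendsto (fun k : ℕ => vnEnt (reg (1 / (k + 1)) A)) atTop (𝓝 (vnEnt A)) := by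
  simp only [vnEnt_reg _ hA]
  rw [vnEnt_eq hA.1]
  refine tendsto_finsetSum _ fun i _ => ?_
  refine (Real.continuous_negMulLog.tendsto _).comp ?_
  have := (tendsto_one_div_add_atTop_nhds_zero_nat (𝕜 := ℝ)).mul_const (rtr A)
  simpa using this.const_add (hA.1.eigenvalues i)

theorem vnEnt_abs_le {A : Mat d} (hA : A.PosSemidef) :
    |vnEnt A| ≤ d * rtr A + |rtr A * Real.log (rtr A)| := by
  have := vnEnt_bound hA
  rw [abs_le] at this ⊢
  have h1 := abs_le.1 (le_refl |rtr A * Real.log (rtr A)|)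
  constructor <;> linarith [h1.1, h1.2]

theorem vnEnt_reg_bound {ε : ℝ} (hε : 0 ≤ ε) (hε1 : ε ≤ 1) {A : Mat d} (hA : A.PosSemidef) :
    |vnEnt (reg ε A)| ≤ d * ((1 + d) * rtr A) +
      (1 + d) * (|rtr A * Real.log (rtr A)| + d * rtr A) := by
  refine (vnEnt_abs_le (reg_psd hε hA)).trans ?_
  have ht := rtr_nonneg hA
  have hd : (0 : ℝ) ≤ d := Nat.cast_nonneg d
  have h1 : 1 + d * ε ≤ 1 + (d : ℝ) := by nlinarith
  have h0 : 0 < 1 + d * ε := by positivity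
  rw [rtr_reg]
  refine add_le_add (by gcongr) ?_
  rcases ht.eq_or_lt with h | h
  · rw [← h]; simp
  rw [Real.log_mul h0.ne' h.ne']
  have hl0 : 0 ≤ Real.log (1 + d * ε) := Real.log_nonneg (by nlinarith [mul_nonneg hd hε])
  have hl1 : Real.log (1 + d * ε) ≤ d := by
    have := Real.log_le_sub_one_of_pos h0; nlinarith
  have e : (1 + d * ε) * rtr A * (Real.log (1 + d * ε) + Real.log (rtr A)) =
    (1 + d * ε) * (rtr A * Real.log (rtr A) + Real.log (1 + d * ε) * rtr A) := by ring
  rw [e, abs_mul, abs_of_pos h0]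
  refine mul_le_mul h1 ?_ (abs_nonneg _) (by positivity)
  refine (abs_add_le _ _).trans ?_
  gcongr
  rw [abs_of_nonneg (by positivity)]
  gcongr

theorem rtr_mul_mlog_le {A B : Mat d} (hA : A.PosSemidef) (hB : B.IsHermitian) {l : ℝ}
    (hl : ∀ i, |Real.log (hB.eigenvalues i)| ≤ l) : |rtr (A * mlog B)| ≤ l * rtr A := by
  obtain ⟨U, h1, h2, h3, h4⟩ := herm_decomp hA.1
  obtain ⟨V, k1, k2, k3, k4⟩ := herm_decomp hB
  have e : rtr (A * mlog B) = ∑ i, ∑ j, Complex.normSq ((Uᴴ * V) i j) *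
      (hA.1.eigenvalues i * Real.log (hB.eigenvalues j)) := by
    rw [← trace_two, ← h4, mlog, k3]
  rw [e, rtr_eq hA.1, Finset.mul_sum]
  refine (Finset.abs_sum_le_sum_abs _ _).trans (Finset.sum_le_sum fun i _ => ?_)
  refine (Finset.abs_sum_le_sum_abs _ _).trans ?_
  have hs := (unitary_sums U V h1 h2 k1 k2).1 i
  calc _ ≤ ∑ j, Complex.normSq ((Uᴴ * V) i j) * (hA.1.eigenvalues i * l) := by
        refine Finset.sum_le_sum fun j _ => ?_
        rw [abs_mul, abs_mul, abs_of_nonneg (Complex.normSq_nonneg _), abs_of_nonneg (hA.eigenvalues_nonneg i)]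
        have := hA.eigenvalues_nonneg i
        have := Complex.normSq_nonneg ((Uᴴ * V) i j)
        gcongr
        exact hl j
    _ = _ := by rw [← Finset.sum_mul, hs]; ring

theorem rtr_mul_mlog_reg_le {ε : ℝ} (hε : 0 < ε) (hε1 : ε ≤ 1) {A B : Mat d} (hA : A.PosSemidef)
    (hB : B.PosSemidef) :
    |rtr (A * mlog (reg ε B))| ≤ (|Real.log (rtr B)| + |Real.log ε| + Real.log 2) * rtr A := by
  refine rtr_mul_mlog_le hA (reg_psd hε.le hB).1 fun i => ?_
  obtain ⟨U, h1, h2, h3, h4⟩ := herm_decomp hB.1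
  obtain ⟨k, hk⟩ := eig_diag h1 (reg_diag ε hB h2 h4) (reg_psd hε.le hB).1 i
  rw [hk]
  have hl2 : 0 ≤ Real.log 2 := Real.log_nonneg (by norm_num)
  have a0 := hB.eigenvalues_nonneg k
  have a1 := eig_le hB k
  rcases (rtr_nonneg hB).eq_or_lt with h | h
  · have : hB.1.eigenvalues k = 0 := by linarith
    rw [this, ← h]; simp; positivity
  have p : 0 < hB.1.eigenvalues k + ε * rtr B := by positivity
  have u : Real.log (hB.1.eigenvalues k + ε * rtr B) ≤ Real.log 2 + Real.log (rtr B) := by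
    rw [← Real.log_mul (by norm_num) h.ne']
    exact Real.log_le_log p (by nlinarith)
  have l : Real.log ε + Real.log (rtr B) ≤ Real.log (hB.1.eigenvalues k + ε * rtr B) := by
    rw [← Real.log_mul hε.ne' h.ne']
    exact Real.log_le_log (by positivity) (by linarith)
  rw [abs_le]
  constructor
  · linarith [neg_abs_le (Real.log ε), neg_abs_le (Real.log (rtr B))]
  · linarith [abs_nonneg (Real.log ε), le_abs_self (Real.log (rtr B))]

theorem rtr_mul_mlog_self {A : Mat d} (hA : A.IsHermitian) : rtr (A * mlog A) = - vnEnt A := by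
  obtain ⟨U, h1, h2, h3, h4⟩ := herm_decomp hA
  have : A * mlog A = U * diagonal (fun i => ((hA.eigenvalues i * Real.log (hA.eigenvalues i) : ℝ) : ℂ)) * Uᴴ := by
    have : ∀ D E : Mat d, U * D * Uᴴ * (U * E * Uᴴ) = U * (D * E) * Uᴴ := fun D E => by
      have : U * D * Uᴴ * (U * E * Uᴴ) = U * D * (Uᴴ * U) * (E * Uᴴ) := by
        simp only [Matrix.mul_assoc]
      rw [this, h1]; simp only [Matrix.mul_assoc, Matrix.one_mul]
    calc A * mlog A = (U * diagonal (fun i => (hA.eigenvalues i : ℂ)) * Uᴴ) *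
          (U * diagonal (fun i => (Real.log (hA.eigenvalues i) : ℂ)) * Uᴴ) := by rw [← h4, mlog, h3]
      _ = _ := by rw [this, diagonal_mul_diagonal]; simp
  rw [this, rtr_mul_comm, ← Matrix.mul_assoc, h1, Matrix.one_mul, vnEnt_eq hA]
  simp [rtr, Real.negMulLog, Finset.sum_neg_distrib]

theorem vnEnt_zero : vnEnt (0 : Mat d) = 0 := by
  have := vnEnt_abs_le (d := d) PosSemidef.zero
  simpa [rtr] using this

theorem relD_zero (B : Mat d) : relD 0 B = 0 := by
  simp [relD, vnEnt_zero, rtr]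

end




/-- integrable, a.e. positive semidefinite matrix valued function -/
structure Good {α : Type*} [MeasurableSpace α] {d : ℕ} (μ : Measure α) (R : α → Mat d) : Prop where
  int : ∀ i j, Integrable (fun a => R a i j) μ
  psd : ∀ᵐ a ∂μ, (R a).PosSemidef

/-- `x ↦ x log x` -/
def xlx (x : ℝ) : ℝ := x * Real.log x

section
variable {α β : Type*} [MeasurableSpace α] [MeasurableSpace β] {d : ℕ} {μ : Measure α} {ν : Measure β}

theorem Good.congr {R R' : α → Mat d} (h : Good μ R) (e : R =ᵐ[μ] R') : Good μ R' := by
  refine ⟨fun i j => (h.int i j).congr ?_, ?_⟩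
  · filter_upwards [e] with a ha; rw [ha]
  · filter_upwards [e, h.psd] with a ha hb; rwa [← ha]

theorem matInt_congr {R R' : α → Mat d} (e : R =ᵐ[μ] R') : matInt μ R = matInt μ R' := by
  ext i j
  simp only [matInt, Matrix.of_apply]
  refine integral_congr_ae ?_
  filter_upwards [e] with a ha; rw [ha]

theorem Good.herm_version {R : α → Mat d} (h : Good μ R) :
    ∃ R' : α → Mat d, R =ᵐ[μ] R' ∧ (∀ i j, Measurable fun a => R' a i j) ∧ ∀ a, (R' a).IsHermitian := by
  let m : Fin d → Fin d → α → ℂ := fun i j => (h.int i j).aestronglyMeasurable.mk _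
  have hm : ∀ i j, Measurable (m i j) := fun i j =>
    ((h.int i j).aestronglyMeasurable.stronglyMeasurable_mk).measurable
  have he : ∀ᵐ a ∂μ, ∀ i j, R a i j = m i j a := by
    rw [ae_all_iff]; intro i
    rw [ae_all_iff]; intro j
    exact (h.int i j).aestronglyMeasurable.ae_eq_mk
  refine ⟨fun a => Matrix.of fun i j => (1 / 2 : ℂ) * (m i j a + star (m j i a)), ?_, fun i j => ?_, fun a => ?_⟩
  · filter_upwards [he, h.psd] with a ha hp
    ext i j
    have := congrFun (congrFun hp.1 i) j
    rw [Matrix.conjTranspose_apply] at this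
    simp only [Matrix.of_apply]
    rw [← ha, ← ha, this]; ring
  · simp only [Matrix.of_apply]
    exact ((hm i j).add (Complex.continuous_conj.measurable.comp (hm j i))).const_mul _
  · ext i j
    simp only [Matrix.conjTranspose_apply, Matrix.of_apply]
    simp; ring

theorem Good.aesm_vnEnt {R : α → Mat d} (h : Good μ R) :
    AEStronglyMeasurable (fun a => vnEnt (R a)) μ := by
  obtain ⟨R', h1, h2, h3⟩ := h.herm_version
  refine (measurable_vnEnt h2 h3).aestronglyMeasurable.congr ?_
  filter_upwards [h1] with a ha; rw [ha]

theorem Good.aesm_mlog {R : α → Mat d} (h : Good μ R) (i j : Fin d) :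
    AEStronglyMeasurable (fun a => mlog (R a) i j) μ := by
  obtain ⟨R', h1, h2, h3⟩ := h.herm_version
  refine (measurable_mlog h2 h3 i j).aestronglyMeasurable.congr ?_
  filter_upwards [h1] with a ha; rw [ha]

theorem integrable_rtr {R : α → Mat d} (h : ∀ i j, Integrable (fun a => R a i j) μ) :
    Integrable (fun a => rtr (R a)) μ := by
  have := integrable_rtr_mul h 1
  simpa using this

theorem Good.tau {R : α → Mat d} (h : Good μ R) : Integrable (fun a => rtr (R a)) μ :=
  integrable_rtr h.int

theorem Good.vnEnt_integrable {R : α → Mat d} (h : Good μ R)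
    (hl : Integrable (fun a => xlx (rtr (R a))) μ) : Integrable (fun a => vnEnt (R a)) μ := by
  refine Integrable.mono' ((h.tau.const_mul (d : ℝ)).add hl.abs) h.aesm_vnEnt ?_
  filter_upwards [h.psd] with a ha
  exact vnEnt_abs_le ha

theorem Good.matInt_psd {R : α → Mat d} (h : Good μ R) : (matInt μ R).PosSemidef := by
  refine Matrix.PosSemidef.of_dotProduct_mulVec_nonneg ?_ fun v => ?_
  · ext i j
    simp only [matInt, Matrix.conjTranspose_apply, Matrix.of_apply, Complex.star_def]
    rw [← integral_conj]
    refine integral_congr_ae ?_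
    filter_upwards [h.psd] with a ha
    exact congrFun (congrFun ha.1 i) j
  · have e : star v ⬝ᵥ (matInt μ R).mulVec v = ∫ a, star v ⬝ᵥ (R a).mulVec v ∂μ := by
      simp only [dotProduct, Matrix.mulVec, matInt, Matrix.of_apply]
      have hi : ∀ i j, Integrable (fun a => R a i j * v j) μ := fun i j => (h.int i j).mul_const _
      rw [integral_finsetSum]
      · refine Finset.sum_congr rfl fun i _ => ?_
        rw [integral_const_mul, integral_finsetSum _ fun j _ => hi i j]
        congr 1
        refine Finset.sum_congr rfl fun j _ => ?_
        rw [integral_mul_const]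
      · exact fun i _ => (integrable_finsetSum _ fun j _ => hi i j).const_mul _
    rw [e]
    have : ∀ᵐ a ∂μ, star v ⬝ᵥ (R a).mulVec v = (((star v ⬝ᵥ (R a).mulVec v).re : ℝ) : ℂ) := by
      filter_upwards [h.psd] with a ha
      have := ha.dotProduct_mulVec_nonneg v
      rw [Complex.nonneg_iff] at this
      apply Complex.ext <;> simp [← this.2]
    rw [integral_congr_ae this, integral_complex_ofReal]
    have : 0 ≤ ∫ a, (star v ⬝ᵥ (R a).mulVec v).re ∂μ := by
      refine integral_nonneg_of_ae ?_
      filter_upwards [h.psd] with a ha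
      have := ha.dotProduct_mulVec_nonneg v
      rw [Complex.nonneg_iff] at this
      exact this.1
    exact_mod_cast this

theorem matInt_reg {G : α → Mat d} (hG : ∀ i j, Integrable (fun a => G a i j) μ) (ε : ℝ) :
    matInt μ (fun a => reg ε (G a)) = reg ε (matInt μ G) := by
  ext i j
  have ht := integrable_rtr hG
  have h2 : Integrable (fun a => ((ε * rtr (G a) : ℝ) : ℂ) * (1 : Mat d) i j) μ :=
    ((ht.const_mul ε).ofReal).mul_const _
  have e : ∀ (H : Mat d), reg ε H i j = H i j + ((ε * rtr H : ℝ) : ℂ) * (1 : Mat d) i j := fun H => rfl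
  rw [e, rtr_matInt hG]
  change ∫ a, reg ε (G a) i j ∂μ = (∫ a, G a i j ∂μ) + _
  simp only [e]
  rw [integral_add (hG i j) h2, integral_mul_const, integral_complex_ofReal, integral_const_mul]

theorem Good.reg {R : α → Mat d} (h : Good μ R) {ε : ℝ} (hε : 0 ≤ ε) :
    Good μ (fun a => reg ε (R a)) := by
  refine ⟨fun i j => ?_, ?_⟩
  · simp only [_root_.reg, Matrix.add_apply, Matrix.smul_apply, smul_eq_mul]
    exact (h.int i j).add (((h.tau.const_mul ε).ofReal).mul_const _)
  · filter_upwards [h.psd] with a ha using reg_psd hε ha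

theorem Good.reg_integrable {R : α → Mat d} (h : Good μ R) {ε : ℝ} (hε : 0 ≤ ε) (hε1 : ε ≤ 1)
    (hl : Integrable (fun a => xlx (rtr (R a))) μ) : Integrable (fun a => vnEnt (_root_.reg ε (R a))) μ := by
  refine Integrable.mono' (((h.tau.const_mul (1 + d : ℝ)).const_mul (d : ℝ)).add
    ((hl.abs.add (h.tau.const_mul (d : ℝ))).const_mul (1 + d : ℝ))) (h.reg hε).aesm_vnEnt ?_
  filter_upwards [h.psd] with a ha
  exact vnEnt_reg_bound hε hε1 ha

theorem Good.reg_tendsto {R : α → Mat d} (h : Good μ R)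
    (hl : Integrable (fun a => xlx (rtr (R a))) μ) :
    Tendsto (fun k : ℕ => ∫ a, vnEnt (_root_.reg (1 / (k + 1)) (R a)) ∂μ) atTop (𝓝 (∫ a, vnEnt (R a) ∂μ)) := by
  refine tendsto_integral_of_dominated_convergence _ (fun k => (h.reg (by positivity)).aesm_vnEnt)
    (((h.tau.const_mul (1 + d : ℝ)).const_mul (d : ℝ)).add
    ((hl.abs.add (h.tau.const_mul (d : ℝ))).const_mul (1 + d : ℝ))) (fun k => ?_) ?_
  · filter_upwards [h.psd] with a ha
    refine vnEnt_reg_bound (by positivity) ?_ ha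
    rw [div_le_one (by positivity)]; linarith [(Nat.cast_nonneg k : (0:ℝ) ≤ k)]
  · filter_upwards [h.psd] with a ha using vnEnt_reg_tendsto ha

theorem fiber {A B : α → Mat d} (hA : Good μ A) (hB : Good μ B)
    (hAB : ∀ᵐ a ∂μ, (B a).PosDef ∨ A a = 0) (hC : (matInt μ A).PosDef) (hD : (matInt μ B).PosDef)
    (hi : Integrable (fun a => relD (A a) (B a)) μ) :
    relD (matInt μ A) (matInt μ B) ≤ ∫ a, relD (A a) (B a) ∂μ := by
  obtain ⟨H, K, h1, h2⟩ := exists_tangent hC hD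
  have i1 := integrable_rtr_mul hA.int H
  have i2 := integrable_rtr_mul hB.int K
  have i3 : Integrable (fun a => rtr (H * A a) + rtr (K * B a)) μ := i1.add i2
  have i4 : Integrable (fun a => rtr (H * A a) + rtr (K * B a) + rtr (A a)) μ := i3.add hA.tau
  rw [h2, rtr_mul_matInt hA.int, rtr_mul_matInt hB.int, rtr_matInt hA.int, rtr_matInt hB.int,
    ← integral_add i1 i2, ← integral_add i3 hA.tau, ← integral_sub i4 hB.tau]
  refine integral_mono_ae (((i1.add i2).add hA.tau).sub hB.tau) hi ?_
  filter_upwards [hA.psd, hB.psd, hAB] with a ha hb hab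
  exact h1 _ _ ha hb hab

end




section
variable {α β : Type*} [MeasurableSpace α] [MeasurableSpace β] {d : ℕ} {μ : Measure α} {ν : Measure β}

/-- first marginal -/
def mF (ν : Measure β) (R : α × β → Mat d) (x : α) : Mat d := matInt ν fun y => R (x, y)
/-- second marginal -/
def mS (μ : Measure α) (R : α × β → Mat d) (y : β) : Mat d := matInt μ fun x => R (x, y)

theorem Good.comp {R : β → Mat d} (h : Good ν R) {f : α → β} (hf : MeasurePreserving f μ ν) :
    Good μ (fun a => R (f a)) :=
  ⟨fun i j => hf.integrable_comp_of_integrable (h.int i j), hf.quasiMeasurePreserving.ae h.psd⟩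

variable [SFinite μ] [SFinite ν]

theorem Good.swap {R : α × β → Mat d} (h : Good (μ.prod ν) R) : Good (ν.prod μ) (fun p => R p.swap) :=
  h.comp Measure.measurePreserving_swap

theorem Good.fibF {R : α × β → Mat d} (h : Good (μ.prod ν) R) : ∀ᵐ x ∂μ, Good ν (fun y => R (x, y)) := by
  have : ∀ᵐ x ∂μ, ∀ i j, Integrable (fun y => R (x, y) i j) ν := by
    rw [ae_all_iff]; intro i; rw [ae_all_iff]; intro j
    exact (h.int i j).prod_right_ae
  filter_upwards [this, Measure.ae_ae_of_ae_prod h.psd] with x h1 h2 using ⟨h1, h2⟩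

theorem Good.fibS {R : α × β → Mat d} (h : Good (μ.prod ν) R) : ∀ᵐ y ∂ν, Good μ (fun x => R (x, y)) :=
  h.swap.fibF

theorem Good.fst {R : α × β → Mat d} (h : Good (μ.prod ν) R) : Good μ (mF ν R) := by
  refine ⟨fun i j => (h.int i j).integral_prod_left, ?_⟩
  filter_upwards [h.fibF] with x hx using hx.matInt_psd

theorem Good.snd {R : α × β → Mat d} (h : Good (μ.prod ν) R) : Good ν (mS μ R) := h.swap.fst

theorem matInt_fst {R : α × β → Mat d} (h : ∀ i j, Integrable (fun p => R p i j) (μ.prod ν)) :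
    matInt (μ.prod ν) R = matInt μ (mF ν R) := by
  ext i j
  exact integral_prod _ (h i j)

theorem matInt_snd {R : α × β → Mat d} (h : ∀ i j, Integrable (fun p => R p i j) (μ.prod ν)) :
    matInt (μ.prod ν) R = matInt ν (mS μ R) := by
  ext i j
  exact integral_prod_symm _ (h i j)

theorem zero_ae {f : α × β → ℝ} (hf : Integrable f (μ.prod ν)) (h0 : 0 ≤ᵐ[μ.prod ν] f) :
    ∀ᵐ p ∂(μ.prod ν), (∫ y, f (p.1, y) ∂ν) = 0 → f p = 0 := by
  let m := hf.aestronglyMeasurable.mk f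
  have hm : Measurable m := hf.aestronglyMeasurable.stronglyMeasurable_mk.measurable
  have hfm : f =ᵐ[μ.prod ν] m := hf.aestronglyMeasurable.ae_eq_mk
  have hg := hf.integral_prod_left.aestronglyMeasurable
  let g := hg.mk _
  have hgm : Measurable g := hg.stronglyMeasurable_mk.measurable
  have hge : (fun x => ∫ y, f (x, y) ∂ν) =ᵐ[μ] g := hg.ae_eq_mk
  have key : ∀ᵐ p ∂(μ.prod ν), g p.1 = 0 → m p = 0 := by
    rw [Measure.ae_prod_iff_ae_ae]
    · filter_upwards [hge, Measure.ae_ae_of_ae_prod hfm, Measure.ae_ae_of_ae_prod h0, hf.prod_right_ae]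
        with x h1 h2 h3 h4
      by_cases hx : g x = 0
      · rw [hx] at h1
        rw [integral_eq_zero_iff_of_nonneg_ae h3 h4] at h1
        filter_upwards [h1, h2] with y h5 h6 _
        rw [← h6]; exact h5
      · exact Eventually.of_forall fun y h => absurd h hx
    · have a1 : MeasurableSet {p : α × β | g p.1 = 0} := (hgm.comp measurable_fst) (measurableSet_singleton 0)
      have a2 : MeasurableSet {p : α × β | m p = 0} := hm (measurableSet_singleton 0)
      have : {p : α × β | g p.1 = 0 → m p = 0} = {p : α × β | g p.1 = 0}ᶜ ∪ {p : α × β | m p = 0} := by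
        ext p; simp only [Set.mem_ofPred_eq, Set.mem_union, Set.mem_compl_iff]; tauto
      exact this ▸ a1.compl.union a2
  filter_upwards [key, hfm, Measure.quasiMeasurePreserving_fst.ae hge] with p h1 h2 h3 h4
  rw [h2]; exact h1 (by rw [← h3]; exact h4)

/-- Strong subadditivity, regularised. -/
theorem SSA_reg {R : α × β → Mat d} (h : Good (μ.prod ν) R)
    (hl : Integrable (fun p => xlx (rtr (R p))) (μ.prod ν))
    (hlX : Integrable (fun p => xlx (rtr (mF ν R p))) μ)
    (hlZ : Integrable (fun p => xlx (rtr (mS μ R p))) ν) {ε : ℝ} (hε : 0 < ε) (hε1 : ε ≤ 1) :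
    (∫ p, vnEnt (reg ε (R p)) ∂(μ.prod ν)) + vnEnt (reg ε (matInt (μ.prod ν) R)) ≤
      (∫ p, vnEnt (reg ε (mF ν R p)) ∂μ) + ∫ p, vnEnt (reg ε (mS μ R p)) ∂ν := by
  have hX := h.fst
  have hZ := h.snd
  have hM := h.matInt_psd
  have htau : ∀ᵐ x ∂μ, rtr (mF ν R x) = ∫ y, rtr (R (x, y)) ∂ν := by
    filter_upwards [h.fibF] with x hx using rtr_matInt hx.int
  have htauZ : ∀ᵐ y ∂ν, rtr (mS μ R y) = ∫ x, rtr (R (x, y)) ∂μ := by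
    filter_upwards [h.fibS] with x hx using rtr_matInt hx.int
  have hnn : 0 ≤ᵐ[μ.prod ν] fun p => rtr (R p) := by
    filter_upwards [h.psd] with p hp using rtr_nonneg hp
  have i1 := h.reg_integrable hε.le hε1 hl
  -- log term
  have il : Integrable (fun p : α × β => Real.log (rtr (mF ν R p.1)) * rtr (R p)) (μ.prod ν) := by
    have hlogm : AEStronglyMeasurable (fun x => Real.log (rtr (mF ν R x))) μ :=
      (Real.measurable_log.comp_aemeasurable hX.tau.aestronglyMeasurable.aemeasurable).aestronglyMeasurable
    have hms : AEStronglyMeasurable (fun p : α × β => Real.log (rtr (mF ν R p.1)) * rtr (R p)) (μ.prod ν) :=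
      hlogm.comp_fst.mul h.tau.aestronglyMeasurable
    rw [integrable_prod_iff hms]
    constructor
    · filter_upwards [h.tau.prod_right_ae] with x hx
      exact hx.const_mul _
    · refine hlX.abs.congr ?_
      filter_upwards [htau, h.fibF, hX.psd] with x h1 h2 h3
      have : ∀ᵐ y ∂ν, ‖Real.log (rtr (mF ν R (x, y).1)) * rtr (R (x, y))‖ =
          |Real.log (rtr (mF ν R x))| * rtr (R (x, y)) := by
        filter_upwards [h2.psd] with y hy
        rw [norm_mul, Real.norm_eq_abs, Real.norm_eq_abs, abs_of_nonneg (rtr_nonneg hy)]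
      rw [integral_congr_ae this, integral_const_mul, ← h1, xlx, abs_mul, abs_of_nonneg (rtr_nonneg h3)]
      ring
  have i2 : Integrable (fun p : α × β => rtr (reg ε (R p) * mlog (reg ε (mF ν R p.1)))) (μ.prod ν) := by
    have ib : Integrable (fun p : α × β => (|Real.log (rtr (mF ν R p.1))| + |Real.log ε| + Real.log 2) *
        rtr (reg ε (R p))) (μ.prod ν) := by
      have := ((il.abs.add (h.tau.const_mul (|Real.log ε| + Real.log 2))).const_mul (1 + d * ε : ℝ))
      refine this.congr ?_
      filter_upwards [hnn] with p hp
      simp only [Pi.add_apply, abs_mul, rtr_reg]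
      rw [abs_of_nonneg hp]; ring
    refine ib.mono' ?_ ?_
    · simp only [rtr_mul_eq]
      refine Finset.aestronglyMeasurable_fun_sum _ fun i _ => Finset.aestronglyMeasurable_fun_sum _ fun j _ => ?_
      refine Complex.continuous_re.comp_aestronglyMeasurable ?_
      exact ((h.reg hε.le).int i j).aestronglyMeasurable.mul
        (((hX.reg hε.le).aesm_mlog j i).comp_fst)
    · filter_upwards [h.psd, Measure.quasiMeasurePreserving_fst.ae hX.psd] with p h1 h2
      exact rtr_mul_mlog_reg_le hε hε1 (reg_psd hε.le h1) h2
  have e2 : ∫ p : α × β, rtr (reg ε (R p) * mlog (reg ε (mF ν R p.1))) ∂(μ.prod ν) =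
      - ∫ x, vnEnt (reg ε (mF ν R x)) ∂μ := by
    rw [integral_prod _ i2, ← integral_neg]
    refine integral_congr_ae ?_
    filter_upwards [h.fibF, hX.psd] with x hx hp
    rw [← rtr_mul_mlog_self (reg_psd hε.le hp).1]
    have := rtr_mul_matInt (hx.reg hε.le).int (mlog (reg ε (mF ν R x)))
    rw [matInt_reg hx.int] at this
    rw [rtr_mul_comm]
    refine Eq.trans ?_ this.symm
    exact integral_congr_ae (Eventually.of_forall fun y => rtr_mul_comm _ _)
  have iF : Integrable (fun p : α × β => relD (reg ε (R p)) (reg ε (mF ν R p.1))) (μ.prod ν) :=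
    i1.neg.sub i2
  have eF : ∫ p : α × β, relD (reg ε (R p)) (reg ε (mF ν R p.1)) ∂(μ.prod ν) =
      - (∫ p, vnEnt (reg ε (R p)) ∂(μ.prod ν)) + ∫ x, vnEnt (reg ε (mF ν R x)) ∂μ := by
    simp only [relD]
    rw [integral_sub i1.fun_neg i2, e2, integral_neg]; ring
  have i3 : Integrable (fun z => rtr (reg ε (mS μ R z) * mlog (reg ε (matInt (μ.prod ν) R)))) ν := by
    have := integrable_rtr_mul (hZ.reg hε.le).int (mlog (reg ε (matInt (μ.prod ν) R)))
    refine this.congr (Eventually.of_forall fun y => rtr_mul_comm _ _)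
  have i4 := hZ.reg_integrable hε.le hε1 hlZ
  have e3 : ∫ z, rtr (reg ε (mS μ R z) * mlog (reg ε (matInt (μ.prod ν) R))) ∂ν =
      - vnEnt (reg ε (matInt (μ.prod ν) R)) := by
    rw [← rtr_mul_mlog_self (reg_psd hε.le hM).1]
    have := rtr_mul_matInt (hZ.reg hε.le).int (mlog (reg ε (matInt (μ.prod ν) R)))
    rw [matInt_reg hZ.int, ← matInt_snd h.int] at this
    rw [rtr_mul_comm]
    refine Eq.trans ?_ this.symm
    exact integral_congr_ae (Eventually.of_forall fun y => rtr_mul_comm _ _)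
  have hM0 : ∀ᵐ z ∂ν, rtr (matInt (μ.prod ν) R) = 0 → rtr (mS μ R z) = 0 := by
    by_cases h0 : rtr (matInt (μ.prod ν) R) = 0
    · rw [matInt_snd h.int, rtr_matInt hZ.int, integral_eq_zero_iff_of_nonneg_ae] at h0
      · filter_upwards [h0] with z hz _ using hz
      · filter_upwards [hZ.psd] with z hz using rtr_nonneg hz
      · exact hZ.tau
    · exact Eventually.of_forall fun z hz => absurd hz h0
  have hX0 : ∀ᵐ p ∂(μ.prod ν), rtr (mF ν R p.1) = 0 → rtr (R p) = 0 := by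
    filter_upwards [zero_ae h.tau hnn, Measure.quasiMeasurePreserving_fst.ae htau] with p h1 h2 h3
    exact h1 (by rw [← h2]; exact h3)
  have hX0' : ∀ᵐ z ∂ν, ∀ᵐ x ∂μ, rtr (mF ν R x) = 0 → rtr (R (x, z)) = 0 :=
    Measure.ae_ae_of_ae_prod ((Measure.measurePreserving_swap (μ := ν) (ν := μ)).quasiMeasurePreserving.ae hX0)
  have main : ∀ᵐ z ∂ν, relD (reg ε (mS μ R z)) (reg ε (matInt (μ.prod ν) R)) ≤
      ∫ x, relD (reg ε (R (x, z))) (reg ε (mF ν R x)) ∂μ := by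
    filter_upwards [h.fibS, hM0, hX0', hZ.psd, iF.prod_left_ae] with z hz h0 hx0 hzp hzi
    rcases (rtr_nonneg hzp).eq_or_lt with hz0 | hz0
    · have e0 := eq_zero_of_rtr hzp hz0.symm
      rw [e0, reg_zero_mat, relD_zero]
      refine integral_nonneg_of_ae ?_
      have : rtr (mS μ R z) = ∫ x, rtr (R (x, z)) ∂μ := rtr_matInt hz.int
      rw [← hz0, eq_comm, integral_eq_zero_iff_of_nonneg_ae] at this
      · filter_upwards [this, hz.psd] with x hx hxp
        have : R (x, z) = 0 := eq_zero_of_rtr hxp hx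
        rw [this, reg_zero_mat, relD_zero]; rfl
      · filter_upwards [hz.psd] with z hz using rtr_nonneg hz
      · exact hz.tau
    · have hMp : 0 < rtr (matInt (μ.prod ν) R) :=
        lt_of_le_of_ne (rtr_nonneg hM) fun h => hz0.ne' (h0 h.symm)
      have eA : matInt μ (fun x => reg ε (R (x, z))) = reg ε (mS μ R z) := matInt_reg hz.int ε
      have eB : matInt μ (fun x => reg ε (mF ν R x)) = reg ε (matInt (μ.prod ν) R) := by
        rw [matInt_reg hX.int, ← matInt_fst h.int]
      have := fiber (hz.reg hε.le) (hX.reg hε.le) ?_ (eA ▸ reg_posDef hε hzp hz0)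
        (eB ▸ reg_posDef hε hM hMp) hzi
      · rwa [eA, eB] at this
      · filter_upwards [hX.psd, hx0, hz.psd] with x hx h1 h2
        rcases (rtr_nonneg hx).eq_or_lt with h3 | h3
        · right; rw [eq_zero_of_rtr h2 (h1 h3.symm), reg_zero_mat]
        · left; exact reg_posDef hε hx h3
  have fin : ∫ z, relD (reg ε (mS μ R z)) (reg ε (matInt (μ.prod ν) R)) ∂ν ≤
      ∫ p : α × β, relD (reg ε (R p)) (reg ε (mF ν R p.1)) ∂(μ.prod ν) := by
    rw [integral_prod_symm _ iF]
    exact integral_mono_ae (i4.neg.sub i3) iF.integral_prod_right main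
  rw [eF] at fin
  simp only [relD] at fin
  rw [integral_sub i4.fun_neg i3, e3, integral_neg] at fin
  linarith

/-- Strong subadditivity. -/
theorem SSA0 {R : α × β → Mat d} (h : Good (μ.prod ν) R)
    (hl : Integrable (fun p => xlx (rtr (R p))) (μ.prod ν))
    (hlX : Integrable (fun p => xlx (rtr (mF ν R p))) μ)
    (hlZ : Integrable (fun p => xlx (rtr (mS μ R p))) ν) :
    (∫ p, vnEnt (R p) ∂(μ.prod ν)) + vnEnt (matInt (μ.prod ν) R) ≤
      (∫ p, vnEnt (mF ν R p) ∂μ) + ∫ p, vnEnt (mS μ R p) ∂ν := by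
  refine le_of_tendsto_of_tendsto' ((h.reg_tendsto hl).add (vnEnt_reg_tendsto h.matInt_psd))
    ((h.fst.reg_tendsto hlX).add (h.snd.reg_tendsto hlZ)) fun k => ?_
  refine SSA_reg h hl hlX hlZ (by positivity) ?_
  rw [div_le_one (by positivity)]; linarith [(Nat.cast_nonneg k : (0:ℝ) ≤ k)]

end




section
variable {ω α β : Type*} [MeasurableSpace ω] [MeasurableSpace α] [MeasurableSpace β] {d : ℕ}
  {θ : Measure ω} {μ : Measure α} {ν : Measure β} [SFinite θ] [SFinite μ] [SFinite ν]

/-- marginal on the first two components -/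
def m12 (ν : Measure β) (R : ω × (α × β) → Mat d) (p : ω × α) : Mat d := matInt ν fun z => R (p.1, (p.2, z))
/-- marginal on the first and third components -/
def m13 (μ : Measure α) (R : ω × (α × β) → Mat d) (p : ω × β) : Mat d := matInt μ fun x => R (p.1, (x, p.2))

theorem Good.m12 {R : ω × (α × β) → Mat d} (h : Good (θ.prod (μ.prod ν)) R) :
    Good (θ.prod μ) (m12 ν R) := by
  have h2 : MeasurePreserving (MeasurableEquiv.prodAssoc : (ω × α) × β ≃ᵐ ω × α × β)
      ((θ.prod μ).prod ν) (θ.prod (μ.prod ν)) := measurePreserving_prodAssoc θ μ ν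
  exact (h.comp h2).fst

theorem mp_swap2 : MeasurePreserving (fun p : ω × (β × α) => (p.1, p.2.swap)) (θ.prod (ν.prod μ)) (θ.prod (μ.prod ν)) :=
  (MeasurePreserving.id θ).prod Measure.measurePreserving_swap

theorem Good.m13 {R : ω × (α × β) → Mat d} (h : Good (θ.prod (μ.prod ν)) R) :
    Good (θ.prod ν) (m13 μ R) :=
  (h.comp (mp_swap2 (ν := ν) (μ := μ))).m12

/-- Strong subadditivity with a classical conditioning variable -/
theorem SSA {R : ω × (α × β) → Mat d} (h : Good (θ.prod (μ.prod ν)) R)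
    (hl : Integrable (fun p => xlx (rtr (R p))) (θ.prod (μ.prod ν)))
    (hlW : Integrable (fun p => xlx (rtr (mF (μ.prod ν) R p))) θ)
    (hl12 : Integrable (fun p => xlx (rtr (m12 ν R p))) (θ.prod μ))
    (hl13 : Integrable (fun p => xlx (rtr (m13 μ R p))) (θ.prod ν)) :
    (∫ p, vnEnt (R p) ∂(θ.prod (μ.prod ν))) + ∫ w, vnEnt (mF (μ.prod ν) R w) ∂θ ≤
      (∫ p, vnEnt (m12 ν R p) ∂(θ.prod μ)) + ∫ p, vnEnt (m13 μ R p) ∂(θ.prod ν) := by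
  have i0 := h.vnEnt_integrable hl
  have iW := h.fst.vnEnt_integrable hlW
  have i12 := h.m12.vnEnt_integrable hl12
  have i13 := h.m13.vnEnt_integrable hl13
  rw [integral_prod _ i0, integral_prod _ i12, integral_prod _ i13,
    ← integral_add i0.integral_prod_left iW, ← integral_add i12.integral_prod_left i13.integral_prod_left]
  refine integral_mono_ae (i0.integral_prod_left.add iW) (i12.integral_prod_left.add i13.integral_prod_left) ?_
  filter_upwards [h.fibF, hl.prod_right_ae, hl12.prod_right_ae, hl13.prod_right_ae] with w h1 h2 h3 h4
  exact SSA0 h1 h2 h3 h4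
end

section
theorem xlx_tangent {a b : ℝ} (ha : 0 ≤ a) (hb : 0 < b) : xlx b + (Real.log b + 1) * (a - b) ≤ xlx a := by
  unfold xlx
  rcases ha.eq_or_lt with h | h
  · subst h; simp; nlinarith
  have := Real.log_le_sub_one_of_pos (div_pos hb h)
  rw [Real.log_div hb.ne' h.ne'] at this
  have h2 := mul_le_mul_of_nonneg_left this h.le
  have : a * (b / a - 1) = b - a := by field_simp
  rw [this] at h2
  nlinarith

theorem xlx_mul {a b : ℝ} : xlx (a * b) = xlx a * b + a * xlx b := by
  unfold xlx
  by_cases ha : a = 0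
  · simp [ha]
  by_cases hb : b = 0
  · simp [hb]
  rw [Real.log_mul ha hb]; ring

theorem measurable_xlx : Measurable xlx := measurable_id.mul Real.measurable_log

/-- a noise probability density -/
structure Noise {F : Type*} [MeasurableSpace F] (ν : Measure F) (g : F → ℝ) : Prop where
  nn : ∀ z, 0 ≤ g z
  int : Integrable g ν
  one : ∫ z, g z ∂ν = 1
  ent : Integrable (fun z => xlx (g z)) ν

variable {E F : Type*} [AddCommGroup E] [MeasurableSpace E] [MeasurableAdd₂ E] [MeasurableNeg E] [MeasurableSub₂ E]
  [MeasurableSpace F] {μ : Measure E} {ν : Measure F} [SFinite μ] [SFinite ν] [μ.IsAddRightInvariant]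
  {d : ℕ} {g : F → ℝ} {L : F → E} {R : E → Mat d}

theorem mp_shear (hL : Measurable L) :
    MeasurePreserving (fun p : E × F => (p.1 - L p.2, p.2)) (μ.prod ν) (μ.prod ν) := by
  have h : MeasurePreserving (fun p : F × E => (p.1, p.2 - L p.1)) (ν.prod μ) (ν.prod μ) := by
    refine MeasurePreserving.skew_product (g := fun z e => e - L z) (MeasurePreserving.id ν) ?_ ?_
    · exact measurable_snd.sub (hL.comp measurable_fst)
    · exact Eventually.of_forall fun z => (measurePreserving_sub_right μ (L z)).map_eq
  exact (Measure.measurePreserving_swap.comp h).comp Measure.measurePreserving_swap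

/-- joint density of the noisy variable and the noise -/
def RN (g : F → ℝ) (L : F → E) (R : E → Mat d) (p : E × F) : Mat d := ((g p.2 : ℝ) : ℂ) • R (p.1 - L p.2)

theorem good_tensor (hg : Noise ν g) (h : Good μ R) :
    Good (μ.prod ν) (fun p => ((g p.2 : ℝ) : ℂ) • R p.1) := by
  refine ⟨fun i j => ?_, ?_⟩
  · have := (h.int i j).mul_prod (ν := ν) (hg.int.ofReal (𝕜 := ℂ))
    refine this.congr (Eventually.of_forall fun p => ?_)
    simp [mul_comm]
  · filter_upwards [Measure.quasiMeasurePreserving_fst.ae h.psd] with p hp using psd_smul (hg.nn _) hp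

theorem good_RN (hg : Noise ν g) (hL : Measurable L) (h : Good μ R) : Good (μ.prod ν) (RN g L R) :=
  (good_tensor hg h).comp (mp_shear hL)

theorem rtr_RN (p : E × F) : rtr (RN g L R p) = g p.2 * rtr (R (p.1 - L p.2)) := rtr_smul _ _

theorem RN_xlx (hg : Noise ν g) (hL : Measurable L) (h : Good μ R)
    (hl : Integrable (fun a => xlx (rtr (R a))) μ) :
    Integrable (fun p => xlx (rtr (RN g L R p))) (μ.prod ν) := by
  have h1 : Integrable (fun p : E × F => xlx (g p.2) * rtr (R p.1) + g p.2 * xlx (rtr (R p.1))) (μ.prod ν) := by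
    refine ((h.tau.mul_prod hg.ent).add (hl.mul_prod hg.int)).congr (Eventually.of_forall fun p => ?_)
    simp [mul_comm]
  have h2 := (mp_shear (μ := μ) (ν := ν) hL).integrable_comp_of_integrable h1
  refine h2.congr (Eventually.of_forall fun p => ?_)
  simp only [Function.comp, rtr_RN, xlx_mul]

theorem RN_vnEnt (hg : Noise ν g) (hL : Measurable L) (h : Good μ R)
    (hl : Integrable (fun a => xlx (rtr (R a))) μ) :
    ∫ p, vnEnt (RN g L R p) ∂(μ.prod ν) = (∫ a, vnEnt (R a) ∂μ) - (∫ z, xlx (g z) ∂ν) * ∫ a, rtr (R a) ∂μ := by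
  have iv := h.vnEnt_integrable hl
  have e1 : ∫ p, vnEnt (RN g L R p) ∂(μ.prod ν) =
      ∫ p : E × F, vnEnt (((g p.2 : ℝ) : ℂ) • R p.1) ∂(μ.prod ν) := by
    have hmp := mp_shear (μ := μ) (ν := ν) hL
    have := integral_map hmp.measurable.aemeasurable (f := fun p : E × F => vnEnt (((g p.2 : ℝ) : ℂ) • R p.1))
      (by rw [hmp.map_eq]; exact (good_tensor hg h).aesm_vnEnt)
    rw [hmp.map_eq] at this
    exact this.symm
  have e2 : ∫ p : E × F, vnEnt (((g p.2 : ℝ) : ℂ) • R p.1) ∂(μ.prod ν) =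
      ∫ p : E × F, (vnEnt (R p.1) * g p.2 - rtr (R p.1) * xlx (g p.2)) ∂(μ.prod ν) := by
    refine integral_congr_ae ?_
    filter_upwards [Measure.quasiMeasurePreserving_fst.ae h.psd] with p hp
    rw [vnEnt_smul (hg.nn _) hp, xlx]; ring
  rw [e1, e2, integral_sub (iv.mul_prod hg.int) (h.tau.mul_prod hg.ent), integral_prod_mul (fun a => vnEnt (R a)) g,
    integral_prod_mul (fun a => rtr (R a)) (fun z => xlx (g z)), hg.one]
  ring

/-- the density of the noisy variable -/
def Rp (ν : Measure F) (g : F → ℝ) (L : F → E) (R : E → Mat d) : E → Mat d := mF ν (RN g L R)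

theorem good_Rp (hg : Noise ν g) (hL : Measurable L) (h : Good μ R) : Good μ (Rp ν g L R) :=
  (good_RN hg hL h).fst

theorem Rp_xlx (hg : Noise ν g) (hL : Measurable L) (h : Good μ R)
    (hl : Integrable (fun a => xlx (rtr (R a))) μ) {V : E → ℝ} (hVm : Measurable V) (hV0 : ∀ e, 0 ≤ V e)
    (hVe : Integrable (fun e => Real.exp (-V e)) μ)
    (hVadd : ∀ e f, V (e + f) ≤ 2 * V e + 2 * V f)
    (hVL : Integrable (fun z => V (L z) * g z) ν)
    (hVt : Integrable (fun e => V e * rtr (R e)) μ) :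
    Integrable (fun e => xlx (rtr (Rp ν g L R e))) μ := by
  have hN := good_RN hg hL h
  have hP := good_Rp hg hL h
  have ht : ∀ᵐ e ∂μ, rtr (Rp ν g L R e) = ∫ z, g z * rtr (R (e - L z)) ∂ν := by
    filter_upwards [hN.fibF] with e he
    have := rtr_matInt he.int
    simp only [rtr_RN] at this
    exact this
  -- upper bound
  have iu : Integrable (fun p : E × F => g p.2 * xlx (rtr (R (p.1 - L p.2)))) (μ.prod ν) := by
    have h1 : Integrable (fun p : E × F => g p.2 * xlx (rtr (R p.1))) (μ.prod ν) :=
      (hl.mul_prod hg.int).congr (Eventually.of_forall fun p => mul_comm _ _)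
    exact (mp_shear (μ := μ) (ν := ν) hL).integrable_comp_of_integrable h1
  have iw : Integrable (fun p : E × F => V p.1 * rtr (RN g L R p)) (μ.prod ν) := by
    have h1 : Integrable (fun p : E × F => 2 * (V p.1 * rtr (R p.1) * g p.2) + 2 * (rtr (R p.1) * (V (L p.2) * g p.2))) (μ.prod ν) :=
      ((hVt.mul_prod hg.int).const_mul 2).add ((h.tau.mul_prod hVL).const_mul 2)
    have h2 := (mp_shear (μ := μ) (ν := ν) hL).integrable_comp_of_integrable h1
    refine h2.mono' ((hVm.comp measurable_fst).aestronglyMeasurable.mul hN.tau.aestronglyMeasurable) ?_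
    filter_upwards [hN.psd, (mp_shear (μ := μ) (ν := ν) hL).quasiMeasurePreserving.ae
      (Measure.quasiMeasurePreserving_fst.ae h.psd)] with p hp hq
    simp only [Function.comp]
    rw [norm_mul, Real.norm_eq_abs, Real.norm_eq_abs, abs_of_nonneg (hV0 _), abs_of_nonneg (rtr_nonneg hp), rtr_RN]
    have a1 := hVadd (p.1 - L p.2) (L p.2)
    rw [sub_add_cancel] at a1
    have a2 := mul_le_mul_of_nonneg_right a1 (mul_nonneg (hg.nn p.2) (rtr_nonneg hq))
    refine a2.trans (le_of_eq ?_)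
    ring
  have iw' : Integrable (fun e => V e * rtr (Rp ν g L R e)) μ := by
    refine iw.integral_prod_left.congr ?_
    filter_upwards [hN.fibF] with e he
    have := rtr_matInt he.int
    rw [integral_const_mul, ← this]; rfl
  refine Integrable.mono' ((iu.integral_prod_left.abs).add ((iw'.add hP.tau).add hVe))
    (measurable_xlx.comp_aemeasurable hP.tau.aestronglyMeasurable.aemeasurable).aestronglyMeasurable ?_
  filter_upwards [ht, hP.psd, iu.prod_right_ae, hN.tau.prod_right_ae, hN.fibF,
    Measure.ae_ae_of_ae_prod ((mp_shear (μ := μ) (ν := ν) hL).quasiMeasurePreserving.ae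
      (Measure.quasiMeasurePreserving_fst.ae h.psd))] with e h1 h2 h3 h4 h5 h6
  have b0 := rtr_nonneg h2
  have low := xlx_tangent b0 (Real.exp_pos (-V e))
  have low' : rtr (Rp ν g L R e) - V e * rtr (Rp ν g L R e) - Real.exp (-V e) ≤ xlx (rtr (Rp ν g L R e)) := by
    refine le_trans (le_of_eq ?_) low
    simp only [xlx, Real.log_exp]; ring
  have up : xlx (rtr (Rp ν g L R e)) ≤ |∫ z, g z * xlx (rtr (R (e - L z))) ∂ν| := by
    rcases b0.eq_or_lt with hb | hb
    · rw [← hb]; simp [xlx]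
    refine le_trans ?_ (le_abs_self _)
    set b := rtr (Rp ν g L R e)
    have h4' : Integrable (fun z => g z * rtr (R (e - L z))) ν := by simpa only [rtr_RN] using h4
    have e1 : xlx b = ∫ z, (xlx b - (Real.log b + 1) * b) * g z + (Real.log b + 1) * (g z * rtr (R (e - L z))) ∂ν := by
      rw [integral_add (hg.int.const_mul _) (h4'.const_mul _), integral_const_mul, integral_const_mul, hg.one, ← h1]
      ring
    rw [e1]
    refine integral_mono_ae ((hg.int.const_mul _).add (h4'.const_mul _)) h3 ?_
    filter_upwards [h6] with z hz
    have := mul_le_mul_of_nonneg_left (xlx_tangent (rtr_nonneg hz) hb) (hg.nn z)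
    refine le_trans (le_of_eq ?_) this
    ring
  rw [Real.norm_eq_abs, abs_le]
  have n1 : 0 ≤ V e * rtr (Rp ν g L R e) := mul_nonneg (hV0 e) b0
  have n2 := (Real.exp_pos (-V e)).le
  simp only [Pi.add_apply]
  constructor
  · linarith [abs_nonneg (∫ z, g z * xlx (rtr (R (e - L z))) ∂ν)]
  · linarith
end




theorem gauss_int {n : ℕ} {b : ℝ} (hb : 0 < b) : Integrable (fun z : En n => Real.exp (-b * ‖z‖^2)) := by
  have := GaussianFourier.integrable_cexp_neg_mul_sq_norm_add (V := En n) (b := (b:ℂ)) (by simpa using hb) 0 0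
  refine this.re.congr (Eventually.of_forall fun z => ?_)
  simp only [zero_mul, add_zero]
  rw [show (-(b:ℂ) * (‖z‖:ℂ)^2) = ((-b * ‖z‖^2 : ℝ) : ℂ) by push_cast; ring, ← Complex.ofReal_exp]
  exact Complex.ofReal_re _

theorem gauss_int2 {n : ℕ} {b : ℝ} (hb : 0 < b) : Integrable (fun z : En n => ‖z‖^2 * Real.exp (-b * ‖z‖^2)) := by
  have h2 := (gauss_int (n := n) (half_pos hb)).const_mul (2 / b)
  refine h2.mono' (by fun_prop) (Eventually.of_forall fun z => ?_)
  rw [Real.norm_eq_abs, abs_of_nonneg (by positivity)]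
  have h3 := Real.add_one_le_exp (b / 2 * ‖z‖^2)
  have h4 : ‖z‖^2 ≤ 2 / b * Real.exp (b / 2 * ‖z‖^2) := by
    rw [div_mul_eq_mul_div, le_div_iff₀ hb]; nlinarith
  refine (mul_le_mul_of_nonneg_right h4 (Real.exp_pos _).le).trans (le_of_eq ?_)
  rw [mul_assoc, ← Real.exp_add]; congr 2; ring

theorem gauss_eq {n : ℕ} : gaussDensity n = fun z => (2 * π) ^ (-(n : ℝ) / 2) * Real.exp (-(1/2) * ‖z‖^2) := by
  funext z; unfold gaussDensity; congr 2; ring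

theorem gauss_moment {n : ℕ} : Integrable (fun z : En n => ‖z‖^2 * gaussDensity n z) := by
  rw [gauss_eq]
  refine ((gauss_int2 (n := n) (b := 1/2) (by norm_num)).const_mul ((2 * π) ^ (-(n : ℝ) / 2))).congr (Eventually.of_forall fun z => ?_)
  simp only; ring

theorem gauss_pos {n : ℕ} (z : En n) : 0 < gaussDensity n z := by unfold gaussDensity; positivity

theorem gauss_noise (n : ℕ) : Noise (volume : Measure (En n)) (gaussDensity n) := by
  have hi : Integrable (gaussDensity n) := by
    rw [gauss_eq]; exact (gauss_int (by norm_num)).const_mul _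
  refine ⟨fun z => (gauss_pos z).le, hi, ?_, ?_⟩
  · rw [gauss_eq]
    simp only
    rw [integral_const_mul, GaussianFourier.integral_rexp_neg_mul_sq_norm (by norm_num)]
    rw [finrank_euclideanSpace, Fintype.card_fin, show π / (1/2) = 2 * π by ring, ← Real.rpow_add (by positivity)]
    rw [show -(n:ℝ)/2 + n/2 = 0 by ring, Real.rpow_zero]
  · refine ((hi.const_mul (Real.log ((2 * π) ^ (-(n : ℝ) / 2)))).sub ((gauss_moment (n := n)).const_mul (1/2))).congr (Eventually.of_forall fun z => ?_)
    have : Real.log (gaussDensity n z) = Real.log ((2 * π) ^ (-(n : ℝ) / 2)) - ‖z‖^2/2 := by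
      unfold gaussDensity
      rw [Real.log_mul (by positivity) (by positivity), Real.log_exp]; ring
    simp only [xlx, this, Pi.sub_apply]; ring

/-- representation of a cq-state by its unnormalised density -/
def CqRep {α : Type*} [MeasureSpace α] {d : ℕ} (p : α → ℝ) (ρ R : α → Mat d) : Prop :=
  ∀ᵐ a, 0 ≤ p a ∧ ((p a : ℝ) : ℂ) • ρ a = R a ∧ (p a = 0 ∨ IsState (ρ a))

theorem IsState.tr_one {d : ℕ} {ρ : Mat d} (h : IsState ρ) : rtr ρ = 1 := by
  have := h.2; unfold rtr; rw [this]; simp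

theorem CqRep.tr_eq {α : Type*} [MeasureSpace α] {d : ℕ} {p : α → ℝ} {ρ R : α → Mat d} (h : CqRep p ρ R) :
    ∀ᵐ a, rtr (R a) = p a := by
  filter_upwards [h] with a ⟨h0, h1, h2⟩
  rw [← h1, rtr_smul]
  rcases h2 with h2 | h2
  · simp [h2]
  · rw [h2.tr_one, mul_one]

theorem CqRep.ent_eq {α : Type*} [MeasureSpace α] {d : ℕ} {p : α → ℝ} {ρ R : α → Mat d} (h : CqRep p ρ R) :
    ∀ᵐ a, p a * vnEnt (ρ a) = vnEnt (R a) + xlx (p a) := by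
  filter_upwards [h] with a ⟨h0, h1, h2⟩
  rw [← h1]
  rcases h2 with h2 | h2
  · simp [h2, vnEnt_zero, xlx]
  · rw [vnEnt_smul h0 h2.1, h2.tr_one, xlx]; ring

theorem CqRep.avg {α : Type*} [MeasureSpace α] {d : ℕ} {p : α → ℝ} {ρ R : α → Mat d} (h : CqRep p ρ R) :
    avgState p ρ = matInt volume R := by
  have : avgState p ρ = matInt volume (fun a => ((p a : ℝ) : ℂ) • ρ a) := rfl
  rw [this]
  refine matInt_congr ?_
  filter_upwards [h] with a ⟨h0, h1, h2⟩ using h1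

theorem CqRep.xl_int {α : Type*} [MeasureSpace α] {d : ℕ} {p : α → ℝ} {ρ R : α → Mat d} (h : CqRep p ρ R)
    (hp : Integrable (fun a => p a * Real.log (p a))) : Integrable (fun a => xlx (rtr (R a))) := by
  refine hp.congr ?_
  filter_upwards [h.tr_eq] with a ha
  rw [ha]; rfl

theorem CqRep.cEnt {α : Type*} [MeasureSpace α] {d : ℕ} {p : α → ℝ} {ρ R : α → Mat d} (h : CqRep p ρ R)
    (hR : Good volume R) (hl : Integrable (fun a => xlx (rtr (R a)))) :
    condEnt p ρ = (∫ a, vnEnt (R a)) - vnEnt (matInt volume R) := by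
  unfold condEnt clEnt
  have e : ∫ a, p a * Real.log (p a) = ∫ a, xlx (rtr (R a)) := by
    refine integral_congr_ae ?_
    filter_upwards [h.tr_eq] with a ha
    rw [ha]; rfl
  have e2 : ∫ a, p a * vnEnt (ρ a) = ∫ a, (vnEnt (R a) + xlx (rtr (R a))) := by
    refine integral_congr_ae ?_
    filter_upwards [h.tr_eq, h.ent_eq] with a ha hb
    rw [ha]; exact hb
  rw [h.avg, e, e2, integral_add (hR.vnEnt_integrable hl) hl]; ring

theorem rtr_eq_trace {d : ℕ} {A : Mat d} (h : A.PosSemidef) : A.trace = ((rtr A : ℝ) : ℂ) := by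
  have := Complex.nonneg_iff.1 h.trace_nonneg
  exact Complex.ext rfl (by simpa using this.2.symm)

theorem CqRep.mfst {n d : ℕ} {p : En n × En n → ℝ} {ρ R : En n × En n → Mat d} (h : CqRep p ρ R)
    (hR : Good volume R) : CqRep (margFst p) (margFstState p ρ) (mF volume R) := by
  have hG : Good ((volume : Measure (En n)).prod (volume : Measure (En n))) R := hR
  have h' : ∀ᵐ a ∂((volume : Measure (En n)).prod (volume : Measure (En n))),
    0 ≤ p a ∧ ((p a : ℝ) : ℂ) • ρ a = R a ∧ (p a = 0 ∨ IsState (ρ a)) := h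
  have hr' : ∀ᵐ a ∂((volume : Measure (En n)).prod (volume : Measure (En n))), rtr (R a) = p a := h.tr_eq
  filter_upwards [hG.fibF, hG.fst.psd, Measure.ae_ae_of_ae_prod h', Measure.ae_ae_of_ae_prod hr'] with x hx hpsd h1 hr
  have e1 : matInt volume (fun y => R (x, y)) = Matrix.of fun i j => ∫ y, (p (x, y) : ℂ) * ρ (x, y) i j := by
    have : (Matrix.of fun i j => ∫ y, (p (x, y) : ℂ) * ρ (x, y) i j) = matInt volume (fun y => ((p (x,y) : ℝ) : ℂ) • ρ (x,y)) := rfl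
    rw [this]
    refine matInt_congr ?_
    filter_upwards [h1] with y hy using hy.2.1.symm
  have e2 : rtr (mF volume R x) = margFst p x := by
    have := rtr_matInt hx.int
    refine this.trans (integral_congr_ae ?_)
    filter_upwards [hr] with y hy using hy
  have e3 : margFstState p ρ x = ((margFst p x : ℝ) : ℂ)⁻¹ • mF volume R x := by
    unfold margFstState mF; rw [e1]
  have n0 : 0 ≤ margFst p x := by rw [← e2]; exact rtr_nonneg hpsd
  by_cases hz : margFst p x = 0
  · refine ⟨n0, ?_, Or.inl hz⟩
    rw [hz] at e2
    rw [hz, eq_zero_of_rtr hpsd e2]; simp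
  · have hc : ((margFst p x : ℝ) : ℂ) ≠ 0 := by exact_mod_cast hz
    refine ⟨n0, ?_, Or.inr ⟨?_, ?_⟩⟩
    · rw [e3, smul_smul, mul_inv_cancel₀ hc, one_smul]
    · rw [e3, ← Complex.ofReal_inv]; exact psd_smul (inv_nonneg.2 n0) hpsd
    · rw [e3, Matrix.trace_smul, rtr_eq_trace hpsd, e2, smul_eq_mul, inv_mul_cancel₀ hc]

theorem CqRep.noisy {n d : ℕ} {q : En n → ℝ} {σ R : En n → Mat d} (c : ℝ) (h : CqRep q σ R) :
    CqRep (noisyDensity c q) (noisyState c σ) (RN (gaussDensity n) (fun z => c • z) R) := by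
  have hm : MeasurePreserving (fun p : En n × En n => (p.1 - c • p.2, p.2))
     ((volume : Measure (En n)).prod (volume : Measure (En n))) ((volume : Measure (En n)).prod (volume : Measure (En n))) :=
    mp_shear (L := fun z => c • z) (by fun_prop)
  have := hm.quasiMeasurePreserving.ae (Measure.quasiMeasurePreserving_fst.ae h)
  have h2 : ∀ᵐ p : En n × En n, 0 ≤ q (p.1 - c • p.2) ∧ ((q (p.1 - c • p.2) : ℝ) : ℂ) • σ (p.1 - c • p.2) = R (p.1 - c • p.2) ∧ (q (p.1 - c • p.2) = 0 ∨ IsState (σ (p.1 - c • p.2))) := this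
  filter_upwards [h2] with p ⟨h0, h1, h2⟩
  refine ⟨mul_nonneg (gauss_pos _).le h0, ?_, ?_⟩
  · unfold noisyDensity noisyState RN
    rw [← h1, smul_smul]; push_cast; rfl
  · exact h2.imp (fun h => by simp [noisyDensity, h]) id




theorem CqRep.comp {α β : Type*} [MeasureSpace α] [MeasureSpace β] {d : ℕ} {p : β → ℝ} {ρ R : β → Mat d} (h : CqRep p ρ R)
    {f : α → β} (hf : MeasurePreserving f volume volume) :
    CqRep (fun a => p (f a)) (fun a => ρ (f a)) (fun a => R (f a)) :=
  hf.quasiMeasurePreserving.ae h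

theorem mp_sw {n : ℕ} : MeasurePreserving (Prod.swap : En n × En n → En n × En n) volume volume :=
  Measure.measurePreserving_swap

/-- the map `(s, x) ↦ (x, s - x)` -/
theorem mp_sum {n : ℕ} : MeasurePreserving (fun q : En n × En n => (q.2, q.1 - q.2)) volume volume := by
  have h : MeasurePreserving (fun p : En n × En n => (p.1 - p.2, p.2))
     ((volume : Measure (En n)).prod (volume : Measure (En n))) ((volume : Measure (En n)).prod (volume : Measure (En n))) :=
    mp_shear (L := fun z => z) (by fun_prop)
  exact mp_sw.comp h

theorem CqRep.msnd {n d : ℕ} {p : En n × En n → ℝ} {ρ R : En n × En n → Mat d} (h : CqRep p ρ R)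
    (hR : Good volume R) : CqRep (margSnd p) (margSndState p ρ) (mS volume R) :=
  (h.comp mp_sw).mfst (hR.comp mp_sw)

/-- unnormalised density of the sum -/
def mSum {n d : ℕ} (R : En n × En n → Mat d) : En n → Mat d :=
  mF volume (fun q : En n × En n => R (q.2, q.1 - q.2))

theorem CqRep.msum {n d : ℕ} {p : En n × En n → ℝ} {ρ R : En n × En n → Mat d} (h : CqRep p ρ R)
    (hR : Good volume R) : CqRep (sumDensity p) (sumState p ρ) (mSum R) :=
  (h.comp mp_sum).mfst (hR.comp mp_sum)

theorem gfst {n d : ℕ} {R : En n × En n → Mat d} (hR : Good volume R) : Good volume (mF volume R) :=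
  Good.fst (μ := (volume : Measure (En n))) (ν := (volume : Measure (En n))) hR

theorem gsnd {n d : ℕ} {R : En n × En n → Mat d} (hR : Good volume R) : Good volume (mS volume R) :=
  gfst (hR.comp mp_sw)

theorem gsum {n d : ℕ} {R : En n × En n → Mat d} (hR : Good volume R) : Good volume (mSum R) :=
  gfst (hR.comp mp_sum)

theorem mS_RN {n d : ℕ} {R : En n → Mat d} (c : ℝ) (z : En n) :
    mS volume (RN (gaussDensity n) (fun z => c • z) R) z = ((gaussDensity n z : ℝ) : ℂ) • matInt volume R := by
  ext i j
  simp only [mS, RN, matInt, Matrix.of_apply, Matrix.smul_apply, smul_eq_mul]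
  rw [integral_const_mul, integral_sub_right_eq_self (fun x => R x i j)]

theorem noisyMI_eq {n d : ℕ} {q : En n → ℝ} {σ R : En n → Mat d} (c : ℝ) (h : CqRep q σ R) (hR : Good volume R)
    (hl : Integrable (fun a => xlx (rtr (R a)))) (hm : Integrable (fun a => ‖a‖^2 * rtr (R a))) :
    noisyMI c q σ = (∫ a, vnEnt (Rp volume (gaussDensity n) (fun z => c • z) R a)) - ∫ a, vnEnt (R a) := by
  have hg := gauss_noise n
  have hL : Measurable (fun z : En n => c • z) := by fun_prop
  have hN : Good (volume : Measure (En n × En n)) (RN (gaussDensity n) (fun z => c • z) R) := good_RN hg hL hR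
  have hNl : Integrable (fun p => xlx (rtr (RN (gaussDensity n) (fun z => c • z) R p))) (volume : Measure (En n × En n)) := RN_xlx hg hL hR hl
  have hPl : Integrable (fun e => xlx (rtr (Rp volume (gaussDensity n) (fun z => c • z) R e))) := by
    refine Rp_xlx (V := fun x => ‖x‖^2) hg hL hR hl (by fun_prop) (fun e => by positivity) ?_ ?_ ?_ hm
    · simpa using gauss_int (n := n) one_pos
    · intro e f
      have := norm_add_le e f
      nlinarith [sq_nonneg (‖e‖ - ‖f‖), norm_nonneg (e+f)]
    · refine ((gauss_moment (n := n)).const_mul (c^2)).congr (Eventually.of_forall fun z => ?_)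
      simp only [norm_smul, mul_pow, Real.norm_eq_abs, sq_abs]; ring
  have hrep := h.noisy c
  have hM := hR.matInt_psd
  have hSl : Integrable (fun z => xlx (rtr (mS volume (RN (gaussDensity n) (fun z => c • z) R) z))) := by
    simp only [mS_RN, rtr_smul, xlx_mul]
    exact (hg.ent.mul_const _).add (hg.int.mul_const _)
  have eM2 : matInt volume (mS volume (RN (gaussDensity n) (fun z => c • z) R)) = matInt volume R := by
    ext i j
    simp only [funext (mS_RN (R := R) c)]
    simp only [matInt, Matrix.of_apply, Matrix.smul_apply, smul_eq_mul]
    rw [integral_mul_const, integral_complex_ofReal, hg.one]; simp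
  have eM0 : matInt volume (RN (gaussDensity n) (fun z => c • z) R) = matInt volume R := by
    rw [← eM2]; exact (matInt_snd (μ := (volume : Measure (En n))) (ν := (volume : Measure (En n))) hN.int)
  have eM1 : matInt volume (Rp volume (gaussDensity n) (fun z => c • z) R) = matInt volume R := by
    rw [← eM0]; exact (matInt_fst (μ := (volume : Measure (En n))) (ν := (volume : Measure (En n))) hN.int).symm
  have e3 : ∫ z, vnEnt (mS volume (RN (gaussDensity n) (fun z => c • z) R) z) =
      vnEnt (matInt volume R) - (∫ z, xlx (gaussDensity n z)) * ∫ a, rtr (R a) := by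
    rw [← rtr_matInt hR.int]
    simp only [mS_RN]
    have : ∀ z, vnEnt (((gaussDensity n z : ℝ) : ℂ) • matInt volume R) =
       gaussDensity n z * vnEnt (matInt volume R) - xlx (gaussDensity n z) * rtr (matInt volume R) := fun z =>
      vnEnt_smul (gauss_pos z).le hM
    simp only [this]
    rw [integral_sub (hg.int.mul_const _) (hg.ent.mul_const _), integral_mul_const, integral_mul_const, hg.one]; ring
  have e4 : ∫ p : En n × En n, vnEnt (RN (gaussDensity n) (fun z => c • z) R p) =
     (∫ a, vnEnt (R a)) - (∫ z, xlx (gaussDensity n z)) * ∫ a, rtr (R a) := RN_vnEnt hg hL hR hl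
  unfold noisyMI condMI
  have c1 := (hrep.mfst hN).cEnt (gfst hN) hPl
  rw [c1, (hrep.msnd hN).cEnt (gsnd hN) hSl, hrep.cEnt hN hNl, e3, e4, eM2, eM0]
  have eM1' : matInt volume (mF volume (RN (gaussDensity n) (fun z => c • z) R)) = matInt volume R := eM1
  rw [eM1']
  unfold Rp
  ring




theorem mp_integral {α β : Type*} [MeasurableSpace α] [MeasurableSpace β] {μ : Measure α} {ν : Measure β} {f : α → β}
    (hf : MeasurePreserving f μ ν) {G : β → ℝ} (hG : AEStronglyMeasurable G ν) : ∫ a, G (f a) ∂μ = ∫ b, G b ∂ν := by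
  have := integral_map hf.measurable.aemeasurable (f := G) (by rw [hf.map_eq]; exact hG)
  rw [hf.map_eq] at this
  exact this.symm

section
variable {E F : Type*} [AddCommGroup E] [MeasurableSpace E] [MeasurableAdd₂ E] [MeasurableNeg E] [MeasurableSub₂ E]
  [MeasurableSpace F] {μ : Measure E} {ν : Measure F} [SFinite μ] [SFinite ν] [μ.IsAddRightInvariant]
  {d : ℕ} {g : F → ℝ} {L : F → E} {R : E → Mat d}

theorem matInt_Rp (hg : Noise ν g) (hL : Measurable L) (h : Good μ R) : matInt μ (Rp ν g L R) = matInt μ R := by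
  have hN := good_RN hg hL h
  have e1 : matInt μ (Rp ν g L R) = matInt ν (mS μ (RN g L R)) :=
    (matInt_fst hN.int).symm.trans (matInt_snd hN.int)
  rw [e1]
  ext i j
  simp only [mS, RN, matInt, Matrix.of_apply, Matrix.smul_apply, smul_eq_mul]
  have : ∀ z, ∫ x, (g z : ℂ) * R (x - L z) i j ∂μ = (g z : ℂ) * ∫ x, R x i j ∂μ := fun z => by
    rw [integral_const_mul, integral_sub_right_eq_self (fun x => R x i j)]
  simp only [this]
  rw [integral_mul_const, integral_complex_ofReal, hg.one]; simp
end

section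
variable {n d : ℕ} {R : En n × En n → Mat d}

instance inv_prod : (volume : Measure (En n × En n)).IsAddRightInvariant :=
  inferInstanceAs ((volume : Measure (En n)).prod (volume : Measure (En n))).IsAddRightInvariant

/-- the shift map -/
def L2 {n : ℕ} (a b : ℝ) (z : En n) : En n × En n := (a • z, b • z)

theorem meas_L2 (a b : ℝ) : Measurable (L2 (n := n) a b) := by unfold L2; fun_prop

/-- the joint noisy density -/
def JJ (a b : ℝ) (R : En n × En n → Mat d) : En n × En n → Mat d := Rp volume (gaussDensity n) (L2 a b) R

theorem RN2_good (a b : ℝ) (h : Good (volume : Measure (En n × En n)) R) :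
    Good (((volume : Measure (En n)).prod (volume : Measure (En n))).prod (volume : Measure (En n))) (RN (gaussDensity n) (L2 a b) R) :=
  good_RN (μ := (volume : Measure (En n × En n))) (gauss_noise n) (meas_L2 a b) h

theorem JJ_fst (a b : ℝ) (h : Good (volume : Measure (En n × En n)) R) :
    mF volume (JJ a b R) =ᵐ[(volume : Measure (En n))] Rp volume (gaussDensity n) (fun z => a • z) (mF volume R) := by
  have h1 := ((RN2_good a b h).comp (measurePreserving_prodAssoc (volume : Measure (En n)) (volume : Measure (En n)) (volume : Measure (En n))).symm).fibF
  filter_upwards [h1] with x hx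
  have hs := hx.int
  ext i j
  have := integral_integral_swap (f := fun y z => RN (gaussDensity n) (L2 a b) R ((x, y), z) i j) (μ := (volume : Measure (En n))) (ν := (volume : Measure (En n))) (hs i j)
  refine this.trans ?_
  refine integral_congr_ae (Eventually.of_forall fun z => ?_)
  have e : ∀ y, RN (gaussDensity n) (L2 a b) R ((x, y), z) i j = (gaussDensity n z : ℂ) * R (x - a • z, y - b • z) i j := fun y => rfl
  simp only [e]
  rw [integral_const_mul, integral_sub_right_eq_self (fun y => R (x - a • z, y) i j)]
  rfl

theorem JJ_snd (a b : ℝ) (h : Good (volume : Measure (En n × En n)) R) :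
    mS volume (JJ a b R) =ᵐ[(volume : Measure (En n))] Rp volume (gaussDensity n) (fun z => b • z) (mS volume R) :=
  by
  have h1 := JJ_fst (R := fun q : En n × En n => R q.swap) b a (h.comp mp_sw)
  have e1 : mS volume (JJ a b R) = mF volume (JJ b a (fun q : En n × En n => R q.swap)) := rfl
  have e2 : mS volume R = mF volume (fun q : En n × En n => R q.swap) := rfl
  rw [e1, e2]
  exact h1

theorem JJ_xlx (a b : ℝ) (h : Good (volume : Measure (En n × En n)) R)
    (hl : Integrable (fun q => xlx (rtr (R q))))
    (hx : Integrable (fun q : En n × En n => ‖q.1‖^2 * rtr (R q)))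
    (hy : Integrable (fun q : En n × En n => ‖q.2‖^2 * rtr (R q))) :
    Integrable (fun e => xlx (rtr (JJ a b R e))) := by
  have key : ∀ e f : En n, ‖e + f‖^2 ≤ 2 * ‖e‖^2 + 2 * ‖f‖^2 := fun e f => by
    have := norm_add_le e f
    nlinarith [sq_nonneg (‖e‖ - ‖f‖), norm_nonneg (e+f)]
  refine Rp_xlx (V := fun q : En n × En n => ‖q.1‖^2 + ‖q.2‖^2) (gauss_noise n) (meas_L2 a b) h hl (by fun_prop)
    (fun e => by positivity) ?_ ?_ ?_ ?_
  · have h1 : Integrable (fun x : En n => Real.exp (-‖x‖^2)) := by simpa using gauss_int (n := n) one_pos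
    have h2 : Integrable (fun q : En n × En n => Real.exp (-‖q.1‖^2) * Real.exp (-‖q.2‖^2)) := h1.mul_prod h1
    refine h2.congr (Eventually.of_forall fun q => ?_)
    simp only
    rw [← Real.exp_add]; congr 1; ring
  · intro e f
    have h1 := key e.1 f.1
    have h2 := key e.2 f.2
    simp only [Prod.fst_add, Prod.snd_add]; linarith
  · refine ((gauss_moment (n := n)).const_mul (a^2 + b^2)).congr (Eventually.of_forall fun z => ?_)
    simp only [L2, norm_smul, mul_pow, Real.norm_eq_abs, sq_abs]; ring
  · refine (hx.add hy).congr (Eventually.of_forall fun z => ?_)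
    simp only [Pi.add_apply]; ring

theorem moment_fst (h : Good (volume : Measure (En n × En n)) R)
    (hx : Integrable (fun q : En n × En n => ‖q.1‖^2 * rtr (R q))) :
    Integrable (fun x : En n => ‖x‖^2 * rtr (mF volume R x)) := by
  have h' : Good ((volume : Measure (En n)).prod (volume : Measure (En n))) R := h
  have hx' : Integrable (fun q : En n × En n => ‖q.1‖^2 * rtr (R q)) ((volume : Measure (En n)).prod (volume : Measure (En n))) := hx
  refine hx'.integral_prod_left.congr ?_
  filter_upwards [h'.fibF] with x hx
  rw [integral_const_mul]
  congr 1
  exact (rtr_matInt hx.int).symm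

theorem moment_snd (h : Good (volume : Measure (En n × En n)) R)
    (hy : Integrable (fun q : En n × En n => ‖q.2‖^2 * rtr (R q))) :
    Integrable (fun x : En n => ‖x‖^2 * rtr (mS volume R x)) :=
  by
  have e2 : mS volume R = mF volume (fun q : En n × En n => R q.swap) := rfl
  rw [e2]
  have h1 : Integrable (fun q : En n × En n => ‖q.1‖^2 * rtr (R q.swap)) :=
    mp_sw.integrable_comp_of_integrable hy
  exact moment_fst (R := fun q : En n × En n => R q.swap) (h.comp mp_sw) h1

theorem moment_sum (h : Good (volume : Measure (En n × En n)) R)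
    (hx : Integrable (fun q : En n × En n => ‖q.1‖^2 * rtr (R q)))
    (hy : Integrable (fun q : En n × En n => ‖q.2‖^2 * rtr (R q))) :
    Integrable (fun x : En n => ‖x‖^2 * rtr (mSum R x)) := by
  have h1 : Integrable (fun q : En n × En n => ‖q.1 + q.2‖^2 * rtr (R q)) := by
    refine ((hx.const_mul 2).add (hy.const_mul 2)).mono' ?_ ?_
    · exact (by fun_prop : Measurable fun q : En n × En n => ‖q.1 + q.2‖^2).aestronglyMeasurable.mul h.tau.aestronglyMeasurable
    · filter_upwards [h.psd] with q hq
      have r := rtr_nonneg hq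
      rw [Real.norm_eq_abs, abs_of_nonneg (by positivity)]
      have := norm_add_le q.1 q.2
      have k : ‖q.1 + q.2‖^2 ≤ 2 * ‖q.1‖^2 + 2 * ‖q.2‖^2 := by
        nlinarith [sq_nonneg (‖q.1‖ - ‖q.2‖), norm_nonneg (q.1+q.2)]
      refine (mul_le_mul_of_nonneg_right k r).trans (le_of_eq ?_)
      simp only [Pi.add_apply]; ring
  refine moment_fst (h.comp mp_sum) ?_
  refine (mp_sum.integrable_comp_of_integrable h1).congr (Eventually.of_forall fun q => ?_)
  simp [Function.comp]

/-- density of the noisy sum, the noisy first variable and the noise -/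
def QQ (a b : ℝ) (R : En n × En n → Mat d) (q : En n × (En n × En n)) : Mat d :=
  RN (gaussDensity n) (L2 a b) R ((q.2.1, q.1 - q.2.1), q.2.2)

theorem mp_QQ : MeasurePreserving (fun q : En n × (En n × En n) => ((q.2.1, q.1 - q.2.1), q.2.2))
    ((volume : Measure (En n)).prod ((volume : Measure (En n)).prod (volume : Measure (En n)))) (((volume : Measure (En n)).prod (volume : Measure (En n))).prod (volume : Measure (En n))) := by
  have h1 := (measurePreserving_prodAssoc (volume : Measure (En n)) (volume : Measure (En n)) (volume : Measure (En n))).symm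
  have h2 : MeasurePreserving (fun q : En n × En n => (q.2, q.1 - q.2)) ((volume : Measure (En n)).prod (volume : Measure (En n))) ((volume : Measure (En n)).prod (volume : Measure (En n))) := mp_sum
  exact (h2.prod (MeasurePreserving.id (volume : Measure (En n)))).comp h1

theorem QQ_m13 (a b : ℝ) : m13 volume (QQ a b R) = RN (gaussDensity n) (fun z => (a + b) • z) (mSum R) := by
  funext q
  obtain ⟨s, z⟩ := q
  ext i j
  have e : ∀ x, QQ a b R (s, (x, z)) i j = (gaussDensity n z : ℂ) * R (x - a • z, (s - (a + b) • z) - (x - a • z)) i j := fun x => by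
    change (gaussDensity n z : ℂ) * R (x - a • z, s - x - b • z) i j = _
    have : s - x - b • z = (s - (a + b) • z) - (x - a • z) := by rw [add_smul]; abel
    rw [this]
  change ∫ x, QQ a b R (s, (x, z)) i j = (gaussDensity n z : ℂ) * ∫ x, R (x, (s - (a + b) • z) - x) i j
  simp only [e]
  rw [integral_const_mul, integral_sub_right_eq_self (fun y => R (y, (s - (a + b) • z) - y) i j)]

theorem heat_main (a b : ℝ) (h : Good (volume : Measure (En n × En n)) R)
    (hl : Integrable (fun q => xlx (rtr (R q))))
    (hlS : Integrable (fun q => xlx (rtr (mSum R q))))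
    (hlX : Integrable (fun q => xlx (rtr (mF volume R q))))
    (hlY : Integrable (fun q => xlx (rtr (mS volume R q))))
    (hx : Integrable (fun q : En n × En n => ‖q.1‖^2 * rtr (R q)))
    (hy : Integrable (fun q : En n × En n => ‖q.2‖^2 * rtr (R q))) :
    (∫ q, vnEnt (R q)) + (∫ s, vnEnt (Rp volume (gaussDensity n) (fun z => (a + b) • z) (mSum R) s))
      + vnEnt (matInt volume R) ≤
     (∫ s, vnEnt (mSum R s)) + (∫ s, vnEnt (Rp volume (gaussDensity n) (fun z => a • z) (mF volume R) s))
      + (∫ s, vnEnt (Rp volume (gaussDensity n) (fun z => b • z) (mS volume R) s)) := by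
  have hg := gauss_noise n
  have hRN := RN2_good a b h
  have hQ : Good ((volume : Measure (En n)).prod ((volume : Measure (En n)).prod (volume : Measure (En n)))) (QQ a b R) := hRN.comp mp_QQ
  have hJ : Good (volume : Measure (En n × En n)) (JJ a b R) := good_Rp hg (meas_L2 a b) h
  have hlJ := JJ_xlx a b h hl hx hy
  have hlRN : Integrable (fun p => xlx (rtr (RN (gaussDensity n) (L2 a b) R p))) (((volume : Measure (En n)).prod (volume : Measure (En n))).prod (volume : Measure (En n))) :=
    RN_xlx (μ := (volume : Measure (En n × En n))) hg (meas_L2 a b) h hl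
  have hlQ : Integrable (fun p => xlx (rtr (QQ a b R p))) ((volume : Measure (En n)).prod ((volume : Measure (En n)).prod (volume : Measure (En n)))) :=
    mp_QQ.integrable_comp_of_integrable hlRN
  have hc : ∀ c : ℝ, Measurable (fun z : En n => c • z) := fun c => by fun_prop
  have hVL : ∀ c : ℝ, Integrable (fun z : En n => ‖c • z‖^2 * gaussDensity n z) := fun c => by
    refine ((gauss_moment (n := n)).const_mul (c^2)).congr (Eventually.of_forall fun z => ?_)
    simp only [norm_smul, mul_pow, Real.norm_eq_abs, sq_abs]; ring
  have hP : ∀ (c : ℝ) (T : En n → Mat d), Good (volume : Measure (En n)) T → Integrable (fun q => xlx (rtr (T q))) →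
      Integrable (fun x : En n => ‖x‖^2 * rtr (T x)) →
      Integrable (fun e => xlx (rtr (Rp volume (gaussDensity n) (fun z => c • z) T e))) := fun c T hT hTl hTm => by
    refine Rp_xlx (V := fun x => ‖x‖^2) hg (hc c) hT hTl (by fun_prop) (fun e => by positivity) ?_ ?_ (hVL c) hTm
    · simpa using gauss_int (n := n) one_pos
    · intro e f
      have := norm_add_le e f
      nlinarith [sq_nonneg (‖e‖ - ‖f‖), norm_nonneg (e+f)]
  have hPS := hP (a+b) _ (gsum h) hlS (moment_sum h hx hy)
  have hPX := hP a _ (gfst h) hlX (moment_fst h hx)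
  have hPY := hP b _ (gsnd h) hlY (moment_snd h hy)
  have eW : mF ((volume : Measure (En n)).prod (volume : Measure (En n))) (QQ a b R) =ᵐ[(volume : Measure (En n))] Rp volume (gaussDensity n) (fun z => (a + b) • z) (mSum R) := by
    filter_upwards [hQ.fibF] with s hs
    refine (matInt_snd hs.int).trans ?_
    have : ∀ z, mS (volume : Measure (En n)) (fun y => QQ a b R (s, y)) z = m13 volume (QQ a b R) (s, z) := fun z => rfl
    simp only [funext this, QQ_m13]
    rfl
  have s1 := SSA hQ hlQ (hPS.congr (by filter_upwards [eW] with s hs; rw [hs]))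
    (mp_sum.integrable_comp_of_integrable hlJ)
    (by rw [QQ_m13]; exact RN_xlx hg (hc _) (gsum h) hlS)
  have t1 : ∫ p, vnEnt (QQ a b R p) ∂((volume : Measure (En n)).prod ((volume : Measure (En n)).prod (volume : Measure (En n)))) =
      (∫ q, vnEnt (R q)) - (∫ z, xlx (gaussDensity n z)) * ∫ q, rtr (R q) :=
    (mp_integral mp_QQ hRN.aesm_vnEnt).trans (RN_vnEnt (μ := (volume : Measure (En n × En n))) hg (meas_L2 a b) h hl)
  have t2 : ∫ w, vnEnt (mF ((volume : Measure (En n)).prod (volume : Measure (En n))) (QQ a b R) w) = 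
      ∫ s, vnEnt (Rp volume (gaussDensity n) (fun z => (a + b) • z) (mSum R) s) :=
    integral_congr_ae (by filter_upwards [eW] with s hs; rw [hs])
  have t3 : ∫ p, vnEnt (m12 volume (QQ a b R) p) ∂((volume : Measure (En n)).prod (volume : Measure (En n))) = ∫ p, vnEnt (JJ a b R p) :=
    mp_integral mp_sum hJ.aesm_vnEnt
  have t4 : ∫ p, vnEnt (m13 volume (QQ a b R) p) ∂((volume : Measure (En n)).prod (volume : Measure (En n))) = 
      (∫ q, vnEnt (mSum R q)) - (∫ z, xlx (gaussDensity n z)) * ∫ q, rtr (mSum R q) := by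
    rw [QQ_m13]; exact RN_vnEnt hg (hc _) (gsum h) hlS
  have t5 : ∫ q, rtr (mSum R q) = ∫ q, rtr (R q) := by
    have hs := h.comp (mp_sum (n := n))
    rw [← rtr_matInt (gsum h).int]
    have := matInt_fst (μ := (volume : Measure (En n))) (ν := (volume : Measure (En n))) hs.int
    have e : matInt volume (mSum R) = matInt volume (fun q : En n × En n => R (q.2, q.1 - q.2)) := this.symm
    rw [e, rtr_matInt hs.int]
    exact mp_integral mp_sum h.tau.aestronglyMeasurable
  rw [t1, t2, t3, t4, t5] at s1
  have eX := JJ_fst a b h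
  have eY := JJ_snd a b h
  have s2 := SSA0 (μ := (volume : Measure (En n))) (ν := (volume : Measure (En n))) hJ hlJ (hPX.congr (by filter_upwards [eX] with s hs; rw [hs]))
    (hPY.congr (by filter_upwards [eY] with s hs; rw [hs]))
  have u1 : ∫ w, vnEnt (mF (volume : Measure (En n)) (JJ a b R) w) = ∫ s, vnEnt (Rp volume (gaussDensity n) (fun z => a • z) (mF volume R) s) :=
    integral_congr_ae (by filter_upwards [eX] with s hs; rw [hs])
  have u2 : ∫ w, vnEnt (mS (volume : Measure (En n)) (JJ a b R) w) = ∫ s, vnEnt (Rp volume (gaussDensity n) (fun z => b • z) (mS volume R) s) :=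
    integral_congr_ae (by filter_upwards [eY] with s hs; rw [hs])
  have u3 : matInt ((volume : Measure (En n)).prod (volume : Measure (En n))) (JJ a b R) = matInt volume R := matInt_Rp (μ := (volume : Measure (En n × En n))) hg (meas_L2 a b) h
  rw [u1, u2, u3] at s2
  have s2' : (∫ p, vnEnt (JJ a b R p)) + vnEnt (matInt volume R) ≤ _ := s2
  linarith
end

theorem final {n d : ℕ}
    (p : En n × En n → ℝ) (ρ : En n × En n → Matrix (Fin d) (Fin d) ℂ)
    (hcq : IsCQState p ρ)
    (hX2 : Integrable fun z : En n × En n => ‖z.1‖ ^ 2 * p z)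
    (hY2 : Integrable fun z : En n × En n => ‖z.2‖ ^ 2 * p z)
    (hXYfin : EntFinite p ρ)
    (hXfin : EntFinite (margFst p) (margFstState p ρ))
    (hYfin : EntFinite (margSnd p) (margSndState p ρ))
    (hSfin : EntFinite (sumDensity p) (sumState p ρ))
    (hindep : condMI p ρ = 0) :
    ∀ t : ℝ, 0 ≤ t → ∀ l : ℝ, 0 ≤ l → l ≤ 1 →
      noisyMI (Real.sqrt t) (sumDensity p) (sumState p ρ)
        ≤ noisyMI (l * Real.sqrt t) (margFst p) (margFstState p ρ)
          + noisyMI ((1 - l) * Real.sqrt t) (margSnd p) (margSndState p ρ) := by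
  intro t ht l hl0 hl1
  obtain ⟨hpm, hp0, hp1, hρc, hρs⟩ := hcq
  have hpi : Integrable p := by
    by_contra hcon
    rw [integral_undef hcon] at hp1
    exact zero_ne_one hp1
  let R : En n × En n → Mat d := fun q => ((p q : ℝ) : ℂ) • ρ q
  have hrep : CqRep p ρ R := Eventually.of_forall fun q => ⟨hp0 q, rfl, Or.inr (hρs q)⟩
  have hR : Good volume R := by
    refine ⟨fun i j => ?_, Eventually.of_forall fun q => psd_smul (hp0 q) (hρs q).1⟩
    refine hpi.mono' ?_ (Eventually.of_forall fun q => ?_)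
    · have : Measurable fun q => ρ q i j := (hρc.matrix_elem i j).measurable
      exact ((Complex.measurable_ofReal.comp hpm).mul this).aestronglyMeasurable
    · change ‖(p q : ℂ) * ρ q i j‖ ≤ p q
      have h1 := entry_le (hρs q).1 i j
      rw [(hρs q).tr_one] at h1
      rw [norm_mul, Complex.norm_real, Real.norm_eq_abs, abs_of_nonneg (hp0 q)]
      exact mul_le_of_le_one_right (hp0 q) h1
  have htr : ∀ q, rtr (R q) = p q := fun q => by
    change rtr (((p q : ℝ) : ℂ) • ρ q) = p q
    rw [rtr_smul, (hρs q).tr_one, mul_one]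
  have hx : Integrable (fun q : En n × En n => ‖q.1‖^2 * rtr (R q)) := by simpa only [htr] using hX2
  have hy : Integrable (fun q : En n × En n => ‖q.2‖^2 * rtr (R q)) := by simpa only [htr] using hY2
  have rX := hrep.mfst hR
  have rY := hrep.msnd hR
  have rS := hrep.msum hR
  have hl := hrep.xl_int hXYfin.1
  have hlX := rX.xl_int hXfin.1
  have hlY := rY.xl_int hYfin.1
  have hlS := rS.xl_int hSfin.1
  have main := heat_main (l * Real.sqrt t) ((1 - l) * Real.sqrt t) hR hl hlS hlX hlY hx hy
  rw [show l * Real.sqrt t + (1 - l) * Real.sqrt t = Real.sqrt t by ring] at main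
  have eX : matInt volume (mF volume R) = matInt volume R :=
    (matInt_fst (μ := (volume : Measure (En n))) (ν := (volume : Measure (En n))) hR.int).symm
  have eY : matInt volume (mS volume R) = matInt volume R :=
    (matInt_snd (μ := (volume : Measure (En n))) (ν := (volume : Measure (En n))) hR.int).symm
  unfold condMI at hindep
  rw [rX.cEnt (gfst hR) hlX, rY.cEnt (gsnd hR) hlY, hrep.cEnt hR hl, eX, eY] at hindep
  rw [noisyMI_eq _ rX (gfst hR) hlX (moment_fst hR hx), noisyMI_eq _ rY (gsnd hR) hlY (moment_snd hR hy),
    noisyMI_eq _ rS (gsum hR) hlS (moment_sum hR hx hy)]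
  linarith

/-- Mutual information inequality along the heat semigroup, with quantum conditioning:
for `X`, `Y` conditionally independent given the quantum system `M`, for all `t ≥ 0` and
`0 ≤ λ ≤ 1`,
`I(X+Y+√t Z : Z|M) ≤ I(X+λ√t Z : Z|M) + I(Y+(1-λ)√t Z : Z|M)`. -/
theorem mutualInfo_heat_inequality {n d : ℕ}
    (p : En n × En n → ℝ) (ρ : En n × En n → Matrix (Fin d) (Fin d) ℂ)
    (hcq : IsCQState p ρ)
    (hX2 : Integrable fun z : En n × En n => ‖z.1‖ ^ 2 * p z)
    (hY2 : Integrable fun z : En n × En n => ‖z.2‖ ^ 2 * p z)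
    (hXYfin : EntFinite p ρ)
    (hXfin : EntFinite (margFst p) (margFstState p ρ))
    (hYfin : EntFinite (margSnd p) (margSndState p ρ))
    (hSfin : EntFinite (sumDensity p) (sumState p ρ))
    (hindep : condMI p ρ = 0) :
    ∀ t : ℝ, 0 ≤ t → ∀ l : ℝ, 0 ≤ l → l ≤ 1 →
      noisyMI (Real.sqrt t) (sumDensity p) (sumState p ρ)
        ≤ noisyMI (l * Real.sqrt t) (margFst p) (margFstState p ρ)
          + noisyMI ((1 - l) * Real.sqrt t) (margSnd p) (margSndState p ρ) := by
  exact final p ρ hcq hX2 hY2 hXYfin hXfin hYfin hSfin hindep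

end
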